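/- arXiv:2512.25012 — 3 statements merged into one kernel-verified Lean document; each statement's English description precedes it below -/
import Mathlib

section
/- For every real ε > 0, the spectrum of the operator T_ε on ℓ²(ℤ) is exactly the unit circle: spec(T_ε) = {z ∈ ℂ : |z| = 1}. -/
/-!
For ε ≥ 0, `T_ε` is the bounded operator on ℓ²(ℤ) with
`(T_ε f)(n) = ε·f(1)` if `n = 0` and `(T_ε f)(n) = f(n+1)` otherwise.
STATEMENT 0: for every ε > 0, the spectrum of `T_ε` is exactly the unit circle.
-/

/-- Weighted composition operators on `ℓ²` with bounded weights are bounded. -/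
theorem exists_weightedComp {ι : Type*} (e : ι ≃ ι) (a : ι → ℂ) {C : ℝ} (hC : 0 ≤ C)
    (ha : ∀ i, ‖a i‖ ≤ C) :
    ∃ A : lp (fun _ : ι => ℂ) 2 →L[ℂ] lp (fun _ : ι => ℂ) 2,
      ‖A‖ ≤ C ∧ ∀ f i, A f i = a i * f (e i) := by
  have h2 : 0 < (2 : ENNReal).toReal := by simp
  have hsum (f : lp (fun _ : ι => ℂ) 2) (s : Finset ι) :
      ∑ i ∈ s, ‖a i * f (e i)‖ ^ (2 : ENNReal).toReal ≤ (C * ‖f‖) ^ (2 : ENNReal).toReal := by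
    have hf := (e.hasSum_iff).mpr (lp.hasSum_norm h2 f)
    rw [Real.mul_rpow hC (norm_nonneg _)]
    calc ∑ i ∈ s, ‖a i * f (e i)‖ ^ (2 : ENNReal).toReal
        ≤ ∑ i ∈ s, C ^ (2 : ENNReal).toReal * ‖f (e i)‖ ^ (2 : ENNReal).toReal := by
          gcongr with i
          rw [norm_mul, Real.mul_rpow (norm_nonneg _) (norm_nonneg _)]
          gcongr
          exact ha i
      _ = C ^ (2 : ENNReal).toReal * ∑ i ∈ s, ‖f (e i)‖ ^ (2 : ENNReal).toReal := by
          rw [Finset.mul_sum]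
      _ ≤ C ^ (2 : ENNReal).toReal * ‖f‖ ^ (2 : ENNReal).toReal := by
          gcongr
          exact sum_le_hasSum s (fun i _ => by positivity) hf
  let L : lp (fun _ : ι => ℂ) 2 →ₗ[ℂ] lp (fun _ : ι => ℂ) 2 :=
    { toFun := fun f => ⟨fun i => a i * f (e i), memℓp_gen' (hsum f)⟩
      map_add' := fun f g => by
        ext i
        exact mul_add _ _ _
      map_smul' := fun c f => by
        ext i
        exact mul_left_comm _ _ _ }
  exact ⟨L.mkContinuous C fun f => lp.norm_le_of_forall_sum_le h2 (by positivity) (hsum f),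
    L.mkContinuous_norm_le hC _, fun _ _ => rfl⟩

/-- Multiplication by a weight that is bounded above and away from zero is invertible on `ℓ²`. -/
theorem exists_units_diagonal {ι : Type*} (d : ι → ℂ) (hd : ∀ i, d i ≠ 0) {C C' : ℝ}
    (hC : ∀ i, ‖d i‖ ≤ C) (hC' : ∀ i, ‖(d i)⁻¹‖ ≤ C') :
    ∃ D : (lp (fun _ : ι => ℂ) 2 →L[ℂ] lp (fun _ : ι => ℂ) 2)ˣ,
      (∀ f i, D.val f i = d i * f i) ∧ ∀ f i, D⁻¹.val f i = (d i)⁻¹ * f i := by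
  obtain ⟨A, -, hA⟩ := exists_weightedComp (Equiv.refl ι) d (le_max_right C 0)
    fun i => (hC i).trans (le_max_left _ _)
  obtain ⟨B, -, hB⟩ := exists_weightedComp (Equiv.refl ι) (fun i => (d i)⁻¹) (le_max_right C' 0)
    fun i => (hC' i).trans (le_max_left _ _)
  exact ⟨⟨A, B, by ext f i; simp [hA, hB, hd i], by ext f i; simp [hA, hB, hd i]⟩, hA, hB⟩

/-- The bilateral shift is an invertible contraction whose inverse is a contraction. -/
theorem exists_units_shift :
    ∃ S : (lp (fun _ : ℤ => ℂ) 2 →L[ℂ] lp (fun _ : ℤ => ℂ) 2)ˣ,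
      ‖S.val‖ ≤ 1 ∧ ‖S⁻¹.val‖ ≤ 1 ∧ ∀ f n, S.val f n = f (n + 1) := by
  obtain ⟨A, hA1, hA⟩ := exists_weightedComp (Equiv.addRight (1 : ℤ)) (fun _ => 1) zero_le_one
    (by simp)
  obtain ⟨B, hB1, hB⟩ := exists_weightedComp (Equiv.addRight (-1 : ℤ)) (fun _ => 1) zero_le_one
    (by simp)
  exact ⟨⟨A, B, by ext f n; simp [hA, hB], by ext f n; simp [hA, hB]⟩, hA1, hB1,
    fun f n => by simp [hA]⟩

/-- A unit of norm at most one whose inverse has norm at most one has unimodular spectrum. -/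
theorem norm_eq_one_of_mem_spectrum_of_norm_le_one {A : Type*} [NormedRing A] [NormedAlgebra ℂ A]
    [CompleteSpace A] [NormOneClass A] (a : Aˣ) (ha : ‖a.val‖ ≤ 1) (ha' : ‖a⁻¹.val‖ ≤ 1)
    {z : ℂ} (hz : z ∈ spectrum ℂ a.val) : ‖z‖ = 1 := by
  have hle := (spectrum.norm_le_norm_of_mem hz).trans ha
  have hinv := (spectrum.norm_le_norm_of_mem (spectrum.inv₀_mem_inv_iff.mpr hz)).trans ha'
  have hz0 : z ≠ 0 := spectrum.ne_zero_of_mem_of_unit hz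
  rw [norm_inv] at hinv
  exact le_antisymm hle ((inv_le_one₀ (norm_pos_iff.mpr hz0)).mp hinv)

/-- Weighted bilateral shifts have rotation-invariant spectrum. -/
theorem mul_mem_spectrum_of_weightedShift
    (T : lp (fun _ : ℤ => ℂ) 2 →L[ℂ] lp (fun _ : ℤ => ℂ) 2) (w : ℤ → ℂ)
    (hT : ∀ f n, T f n = w n * f (n + 1)) {u z : ℂ} (hu : ‖u‖ = 1) (hz : z ∈ spectrum ℂ T) :
    u * z ∈ spectrum ℂ T := by
  have hu0 : u ≠ 0 := norm_ne_zero_iff.mp (by simp [hu])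
  obtain ⟨M, hM, hM'⟩ := exists_units_diagonal (fun n : ℤ => u ^ n) (fun n => zpow_ne_zero n hu0)
    (C := 1) (C' := 1) (by simp [hu]) (by simp [hu])
  have hconj : M⁻¹.val * T * M.val = Units.mk0 u hu0 • T := by
    ext f n
    simp only [mul_apply_eq_comp, hM', hT, hM, Units.smul_mk0,
      smul_apply, lp.coeFn_smul, Pi.smul_apply, smul_eq_mul, zpow_add_one₀ hu0]
    field_simp [zpow_ne_zero n hu0]
  rw [← spectrum.units_conjugate' (u := M), hconj]
  exact spectrum.smul_mem_smul_iff.mpr hz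

theorem spectrum_shift_perturbed_eq_unit_circle
    (ε : ℝ) (hε : 0 < ε)
    (T : lp (fun _ : ℤ => ℂ) 2 →L[ℂ] lp (fun _ : ℤ => ℂ) 2)
    (hT : ∀ (f : lp (fun _ : ℤ => ℂ) 2) (n : ℤ),
      T f n = if n = 0 then (ε : ℂ) * f 1 else f (n + 1)) :
    spectrum ℂ T = {z : ℂ | ‖z‖ = 1} := by
  have hε0 : (ε : ℂ) ≠ 0 := by exact_mod_cast hε.ne'
  have hT' (f : lp (fun _ : ℤ => ℂ) 2) (n : ℤ) :
      T f n = (if n = 0 then (ε : ℂ) else 1) * f (n + 1) := by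
    rw [hT]
    split_ifs with h <;> simp [h]
  have : Nontrivial (lp (fun _ : ℤ => ℂ) 2) :=
    ⟨lp.single 2 0 1, 0, fun h => by simpa using congrArg (fun f => f 0) h⟩
  obtain ⟨S, hS, hS', hSapply⟩ := exists_units_shift
  obtain ⟨D, hD, hD'⟩ := exists_units_diagonal (fun n : ℤ => if n ≤ 0 then (ε : ℂ) else 1)
    (fun n => by split_ifs <;> simp [hε0]) (C := max ε 1) (C' := max ε⁻¹ 1)
    (fun n => by split_ifs <;> simp [abs_of_pos hε])
    (fun n => by split_ifs <;> simp [abs_of_pos hε])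
  have hconj : T = D.val * S.val * D⁻¹.val := by
    ext f n
    simp only [mul_apply_eq_comp, hT', hD, hSapply, hD']
    rcases lt_trichotomy n 0 with h | rfl | h
    · simp [h.ne, h.le, show n + 1 ≤ 0 by lia, hε0]
    · simp
    · simp [h.ne', h.not_ge, show ¬ n + 1 ≤ 0 by lia]
  have hsub {z : ℂ} (hz : z ∈ spectrum ℂ T) : ‖z‖ = 1 := by
    rw [hconj, spectrum.units_conjugate] at hz
    exact norm_eq_one_of_mem_spectrum_of_norm_le_one S hS hS' hz
  refine Set.Subset.antisymm (fun z hz => hsub hz) fun z (hz : ‖z‖ = 1) => ?_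
  obtain ⟨y, hy⟩ := spectrum.nonempty T
  have hy1 := hsub hy
  have hy0 : y ≠ 0 := norm_ne_zero_iff.mp (by simp [hy1])
  simpa [hy0] using mul_mem_spectrum_of_weightedShift T _ hT' (u := z / y) (by simp [hz, hy1]) hy
end

section
/- The spectrum of the operator T_0 on ℓ²(ℤ) is exactly the closed unit disk: spec(T_0) = {z ∈ ℂ : |z| ≤ 1}. -/
/-!
For ε ≥ 0, `T_ε` is the bounded operator on ℓ²(ℤ) with
`(T_ε f)(n) = ε·f(1)` if `n = 0` and `(T_ε f)(n) = f(n+1)` otherwise.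
STATEMENT 1: the spectrum of `T_0` is exactly the closed unit disk.
-/

/-- The one-sided geometric sequence `0, …, 0, 1, z, z², …`, with its entry `1` at index `1`,
is square-summable when `‖z‖ < 1`. -/
theorem memℓp_two_geometric {z : ℂ} (hz : ‖z‖ < 1) :
    Memℓp (fun n : ℤ => if 1 ≤ n then z ^ (n - 1).toNat else 0) 2 := by
  apply memℓp_gen
  have hinj : Function.Injective (fun k : ℕ => (k : ℤ) + 1) := fun a b h => by
    simpa using h
  rw [← hinj.summable_iff]
  · have hs : Summable fun k : ℕ => (‖z‖ ^ 2) ^ k :=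
      summable_geometric_of_lt_one (by positivity) (pow_lt_one₀ (norm_nonneg z) hz two_ne_zero)
    refine hs.congr fun k => ?_
    simp [← pow_mul, mul_comm]
  · intro n hn
    have h : ¬ 1 ≤ n := fun h => hn ⟨(n - 1).toNat, by grind⟩
    simp [h]

theorem mem_spectrum_shift_cut_of_norm_lt_one
    {T : lp (fun _ : ℤ => ℂ) 2 →L[ℂ] lp (fun _ : ℤ => ℂ) 2}
    (hT : ∀ (f : lp (fun _ : ℤ => ℂ) 2) (n : ℤ), T f n = if n = 0 then 0 else f (n + 1))
    {z : ℂ} (hz : ‖z‖ < 1) : z ∈ spectrum ℂ T := by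
  let f : lp (fun _ : ℤ => ℂ) 2 := ⟨_, memℓp_two_geometric hz⟩
  have hf (n : ℤ) : f n = if 1 ≤ n then z ^ (n - 1).toNat else 0 := rfl
  have heig : T f = z • f := by
    ext n
    rw [hT, lp.coeFn_smul, Pi.smul_apply, hf, hf, smul_eq_mul]
    rcases lt_trichotomy n 0 with h | rfl | h
    · rw [if_neg h.ne, if_neg (by lia), if_neg (by lia), mul_zero]
    · simp
    · rw [if_neg h.ne', if_pos (by lia), if_pos (by lia), ← pow_succ']
      congr 1
      lia
  intro hres
  obtain ⟨u, hu⟩ := spectrum.mem_resolventSet_iff.mp hres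
  have hzero : (u : lp (fun _ : ℤ => ℂ) 2 →L[ℂ] lp (fun _ : ℤ => ℂ) 2) f = 0 := by
    rw [hu, sub_apply, heig, Algebra.algebraMap_eq_smul_one]
    exact sub_self _
  have hf0 : f = 0 := by
    have h := DFunLike.congr_fun u.inv_mul f
    rw [mul_apply_eq_comp, hzero, map_zero] at h
    exact h.symm
  have h1 := hf 1
  simp [hf0] at h1

theorem opNorm_shift_cut_le_one
    {T : lp (fun _ : ℤ => ℂ) 2 →L[ℂ] lp (fun _ : ℤ => ℂ) 2}
    (hT : ∀ (f : lp (fun _ : ℤ => ℂ) 2) (n : ℤ), T f n = if n = 0 then 0 else f (n + 1)) :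
    ‖T‖ ≤ 1 := by
  refine T.opNorm_le_bound zero_le_one fun f => ?_
  rw [one_mul]
  have hp : 0 < (2 : ENNReal).toReal := by norm_num
  refine lp.norm_le_of_forall_sum_le hp (norm_nonneg f) fun s => ?_
  calc ∑ n ∈ s, ‖T f n‖ ^ (2 : ENNReal).toReal
      ≤ ∑ n ∈ s, ‖f (n + 1)‖ ^ (2 : ENNReal).toReal := by
        gcongr with n
        rw [hT]
        split_ifs <;> simp
    _ = ∑ n ∈ s.map (addRightEmbedding 1), ‖f n‖ ^ (2 : ENNReal).toReal := by simp
    _ ≤ ‖f‖ ^ (2 : ENNReal).toReal := lp.sum_rpow_le_norm_rpow hp f _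

theorem spectrum_shift_cut_eq_closed_unit_disk
    (T : lp (fun _ : ℤ => ℂ) 2 →L[ℂ] lp (fun _ : ℤ => ℂ) 2)
    (hT : ∀ (f : lp (fun _ : ℤ => ℂ) 2) (n : ℤ),
      T f n = if n = 0 then 0 else f (n + 1)) :
    spectrum ℂ T = {z : ℂ | ‖z‖ ≤ 1} := by
  have hball : Metric.ball (0 : ℂ) 1 ⊆ spectrum ℂ T := fun z hz =>
    mem_spectrum_shift_cut_of_norm_lt_one hT (mem_ball_zero_iff.mp hz)
  have : Nontrivial (lp (fun _ : ℤ => ℂ) 2) := by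
    by_contra h
    rw [not_nontrivial_iff_subsingleton] at h
    have h0 := hball (Metric.mem_ball_self one_pos)
    rw [spectrum.of_subsingleton] at h0
    exact h0
  refine Set.Subset.antisymm
    (fun z hz => (spectrum.norm_le_norm_of_mem hz).trans (opNorm_shift_cut_le_one hT))
    fun z hz => ?_
  apply closure_minimal hball (spectrum.isClosed T)
  rw [closure_ball 0 one_ne_zero]
  exact mem_closedBall_zero_iff.mpr hz
end

section
/- (Rayleigh–Faber–Krahn inequality) Let n ≥ 1 and let B denote the open unit ball in ℝ^n. For every nonempty bounded open set Ω ⊆ ℝ^n, one has |Ω|^{2/n}·λ_1(Ω) ≥ |B|^{2/n}·λ_1(B), where |·| denotes n-dimensional Lebesgue measure; that is, among bounded open sets of given volume, the ball minimizes the first Dirichlet eigenvalue of the Laplacian. -/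
open MeasureTheory Real

/-- The k-th Dirichlet eigenvalue of the Laplacian on `Ω ⊆ ℝⁿ`, defined variationally as
the infimum, over all `k`-dimensional subspaces `E` of the space of smooth compactly
supported functions with support in `Ω`, of the supremum of the Rayleigh quotient
`(∫_Ω ‖∇u‖²) / (∫_Ω u²)` over nonzero `u ∈ E`. -/
noncomputable def dirichletEig {n : ℕ} (Ω : Set (EuclideanSpace ℝ (Fin n))) (k : ℕ) : ℝ :=
  sInf { r : ℝ | ∃ E : Submodule ℝ (EuclideanSpace ℝ (Fin n) → ℝ),
    Module.finrank ℝ E = k ∧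
    (∀ u ∈ E, ContDiff ℝ (⊤ : ℕ∞) u ∧ HasCompactSupport u ∧ tsupport u ⊆ Ω) ∧
    r = sSup { q : ℝ | ∃ u ∈ E, u ≠ (0 : EuclideanSpace ℝ (Fin n) → ℝ) ∧
        q = (∫ x in Ω, ‖gradient u x‖ ^ 2) / (∫ x in Ω, (u x) ^ 2) } }

section

open scoped ENNReal Pointwise

/-- One-dimensional Brunn-Minkowski inequality. -/
theorem volume_add_volume_le_of_add_subset {A B C : Set ℝ} (hA : MeasurableSet A)
    (hB : MeasurableSet B) (hAn : A.Nonempty) (hBn : B.Nonempty) (h : A + B ⊆ C) :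
    volume A + volume B ≤ volume C := by
  have compact_case : ∀ K L : Set ℝ, IsCompact K → IsCompact L → K.Nonempty → L.Nonempty →
      K ⊆ A → L ⊆ B → volume K + volume L ≤ volume C := by
    intro K L hK hL hKn hLn hKA hLB
    have ha := hK.sSup_mem hKn
    have hb := hL.sInf_mem hLn
    set a := sSup K
    set b := sInf L
    have h1 : volume ((fun x => b + x) '' K) = volume K := by
      simp [Set.image_add_left, measure_preimage_add]
    have h2 : volume ((fun x => a + x) '' L) = volume L := by
      simp [Set.image_add_left, measure_preimage_add]
    have hmeas : MeasurableSet ((fun x => a + x) '' L) :=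
      (hL.image (by fun_prop)).measurableSet
    have h3 : volume (((fun x => b + x) '' K) ∩ ((fun x => a + x) '' L)) = 0 := by
      refine measure_mono_null (t := {a + b}) ?_ (by simp)
      rintro z ⟨⟨x, hx, rfl⟩, ⟨y, hy, hxy⟩⟩
      have h4 : x ≤ a := le_csSup hK.bddAbove hx
      have h5 : b ≤ y := csInf_le hL.bddBelow hy
      simp only [Set.mem_singleton_iff] at *
      linarith
    have h4 := measure_union_add_inter (μ := volume) ((fun x => b + x) '' K) hmeas
    rw [h3, h1, h2, add_zero] at h4
    rw [← h4]
    refine measure_mono ?_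
    rintro z (⟨x, hx, rfl⟩ | ⟨x, hx, rfl⟩)
    · exact h ⟨x, hKA hx, b, hLB hb, add_comm _ _⟩
    · exact h ⟨a, hKA ha, x, hLB hx, rfl⟩
  obtain ⟨a, ha⟩ := hAn
  obtain ⟨b, hb⟩ := hBn
  rw [hA.measure_eq_iSup_isCompact, hB.measure_eq_iSup_isCompact]
  simp only [iSup_and']
  refine ENNReal.biSup_add_biSup_le' ⟨∅, by simp⟩ ⟨∅, by simp⟩ ?_
  rintro K ⟨hKA, hK⟩ L ⟨hLB, hL⟩
  refine le_trans (add_le_add (measure_mono (Set.subset_insert a K))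
    (measure_mono (Set.subset_insert b L))) ?_
  exact compact_case _ _ (hK.insert a) (hL.insert b) (Set.insert_nonempty _ _)
    (Set.insert_nonempty _ _) (Set.insert_subset ha hKA) (Set.insert_subset hb hLB)

theorem prekopa_leindler_one_dim_normalized {f g h : ℝ → ℝ} {p q : ℝ} (hp : 0 < p) (hq : 0 < q)
    (hf : Measurable f) (hg : Measurable g) (hh : Measurable h)
    (hf0 : ∀ x, 0 ≤ f x) (hg0 : ∀ x, 0 ≤ g x) (hh0 : ∀ x, 0 ≤ h x)
    (hf1 : ∀ x, f x ≤ 1) (hg1 : ∀ x, g x ≤ 1)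
    (hfs : ∀ s < 1, ∃ x, s < f x) (hgs : ∀ s < 1, ∃ x, s < g x)
    (H : ∀ s x y, s < f x → s < g y → s < h (p * x + q * y)) :
    ENNReal.ofReal p * (∫⁻ x, ENNReal.ofReal (f x)) +
      ENNReal.ofReal q * (∫⁻ x, ENNReal.ofReal (g x)) ≤ ∫⁻ x, ENNReal.ofReal (h x) := by
  have layer : ∀ F : ℝ → ℝ, (∀ x, 0 ≤ F x) → Measurable F → ∫⁻ x, ENNReal.ofReal (F x) =
      ∫⁻ s in Set.Ioi 0, volume {x | s < F x} := fun F h0 hF =>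
    lintegral_eq_lintegral_meas_lt volume (.of_forall h0) hF.aemeasurable
  rw [layer f hf0 hf, layer g hg0 hg, layer h hh0 hh]
  have anti : ∀ F : ℝ → ℝ, Measurable fun s : ℝ => volume {x | s < F x} := fun F =>
    Antitone.measurable fun s t hst => measure_mono fun x hx => lt_of_le_of_lt hst hx
  rw [← lintegral_const_mul _ (anti f), ← lintegral_const_mul _ (anti g),
    ← lintegral_add_left ((anti f).const_mul _)]
  refine lintegral_mono fun s => ?_
  have hsc : ∀ (F : ℝ → ℝ) (c : ℝ), 0 < c →
      ENNReal.ofReal c * volume {x | s < F x} = volume (c • {x | s < F x}) := by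
    intro F c hc
    rw [Measure.addHaar_smul]
    simp [abs_of_pos hc]
  by_cases hs : s < 1
  · rw [hsc f p hp, hsc g q hq]
    refine volume_add_volume_le_of_add_subset
      ((measurableSet_lt measurable_const hf).const_smul₀ _)
      ((measurableSet_lt measurable_const hg).const_smul₀ _)
      (Set.Nonempty.smul_set (hfs s hs)) (Set.Nonempty.smul_set (hgs s hs)) ?_
    rintro _ ⟨_, ⟨x, hx, rfl⟩, _, ⟨y, hy, rfl⟩, rfl⟩
    exact H s x y hx hy
  · have e1 : {x | s < f x} = ∅ := by
      ext x; simp only [Set.mem_ofPred_eq, Set.mem_empty_iff_false, iff_false, not_lt]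
      exact (hf1 x).trans (not_lt.1 hs)
    have e2 : {x | s < g x} = ∅ := by
      ext x; simp only [Set.mem_ofPred_eq, Set.mem_empty_iff_false, iff_false, not_lt]
      exact (hg1 x).trans (not_lt.1 hs)
    simp [e1, e2]


theorem ennreal_geom_mean_le_arith_mean {p q : ℝ} (hp : 0 < p) (hq : 0 < q) (hpq : p + q = 1)
    (a b : ℝ≥0∞) : a ^ p * b ^ q ≤ ENNReal.ofReal p * a + ENNReal.ofReal q * b := by
  have hc : (p⁻¹).HolderConjugate q⁻¹ := by
    rw [Real.holderConjugate_iff]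
    refine ⟨(one_lt_inv₀ hp).2 (by linarith), by simpa using hpq⟩
  have := ENNReal.young_inequality (a ^ p) (b ^ q) hc
  rwa [← ENNReal.rpow_mul, ← ENNReal.rpow_mul, mul_inv_cancel₀ hp.ne', mul_inv_cancel₀ hq.ne',
    ENNReal.rpow_one, ENNReal.rpow_one, ENNReal.ofReal_inv_of_pos hp, ENNReal.ofReal_inv_of_pos hq,
    div_eq_mul_inv, div_eq_mul_inv, inv_inv, inv_inv, mul_comm a, mul_comm b] at this

theorem prekopa_leindler_one_dim_bounded {f g h : ℝ → ℝ≥0∞} {p q : ℝ} (hp : 0 < p) (hq : 0 < q)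
    (hpq : p + q = 1) (hf : Measurable f) (hg : Measurable g) (hh : Measurable h)
    (hft : ⨆ x, f x ≠ ∞) (hgt : ⨆ x, g x ≠ ∞)
    (H : ∀ x y, f x ^ p * g y ^ q ≤ h (p * x + q * y)) :
    (∫⁻ x, f x) ^ p * (∫⁻ x, g x) ^ q ≤ ∫⁻ x, h x := by
  set a := ⨆ x, f x with ha
  set b := ⨆ x, g x with hb
  have hfa : ∀ x, f x ≤ a := fun x => le_iSup f x
  have hgb : ∀ x, g x ≤ b := fun x => le_iSup g x
  by_cases ha0 : a = 0
  · have : ∀ x, f x = 0 := fun x => le_antisymm (ha0 ▸ hfa x) bot_le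
    simp [this, hp]
  by_cases hb0 : b = 0
  · have : ∀ x, g x = 0 := fun x => le_antisymm (hb0 ▸ hgb x) bot_le
    simp [this, hq]
  set c := a ^ p * b ^ q with hc
  have hc0 : c ≠ 0 := by
    simp [hc, ENNReal.rpow_eq_zero_iff, ha0, hb0, hft, hgt]
  have hct : c ≠ ∞ := ENNReal.mul_ne_top (ENNReal.rpow_ne_top_of_nonneg hp.le hft)
    (ENNReal.rpow_ne_top_of_nonneg hq.le hgt)
  have fl : ∀ x, f x / a ≤ 1 := fun x => ENNReal.div_le_of_le_mul (by simpa using hfa x)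
  have gl : ∀ x, g x / b ≤ 1 := fun x => ENNReal.div_le_of_le_mul (by simpa using hgb x)
  have fnt : ∀ x, f x / a ≠ ∞ := fun x => ne_top_of_le_ne_top ENNReal.one_ne_top (fl x)
  have gnt : ∀ x, g x / b ≠ ∞ := fun x => ne_top_of_le_ne_top ENNReal.one_ne_top (gl x)
  have hnt : ∀ x, min (h x / c) 1 ≠ ∞ := fun x =>
    ne_top_of_le_ne_top ENNReal.one_ne_top (min_le_right _ _)
  have attain : ∀ (F : ℝ → ℝ≥0∞) (A : ℝ≥0∞), A = ⨆ x, F x → A ≠ 0 → A ≠ ∞ →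
      (∀ x, F x / A ≠ ∞) → ∀ s < 1, ∃ x, s < (F x / A).toReal := by
    intro F A hA hA0 hAt hF s hs
    by_cases hs0 : s < 0
    · exact ⟨0, hs0.trans_le ENNReal.toReal_nonneg⟩
    have h1 : ENNReal.ofReal s * A < A := by
      conv_rhs => rw [← one_mul A]
      exact (ENNReal.mul_lt_mul_iff_left hA0 hAt).2 (by simpa using hs)
    conv_rhs at h1 => rw [hA]
    obtain ⟨x, hx⟩ := lt_iSup_iff.1 h1
    refine ⟨x, ?_⟩
    rw [← ENNReal.ofReal_lt_iff_lt_toReal (not_lt.1 hs0) (hF x)]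
    exact (ENNReal.lt_div_iff_mul_lt (.inl hA0) (.inl hAt)).2 hx
  have key := prekopa_leindler_one_dim_normalized (f := fun x => (f x / a).toReal)
    (g := fun x => (g x / b).toReal) (h := fun x => (min (h x / c) 1).toReal) hp hq
    (by fun_prop) (by fun_prop) (by fun_prop) (fun _ => ENNReal.toReal_nonneg)
    (fun _ => ENNReal.toReal_nonneg) (fun _ => ENNReal.toReal_nonneg)
    (fun x => ENNReal.toReal_le_of_le_ofReal zero_le_one (by simpa using fl x))
    (fun x => ENNReal.toReal_le_of_le_ofReal zero_le_one (by simpa using gl x))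
    (attain f a ha ha0 hft fnt) (attain g b hb hb0 hgt gnt) ?_
  · simp only [ENNReal.ofReal_toReal (fnt _), ENNReal.ofReal_toReal (gnt _),
      ENNReal.ofReal_toReal (hnt _)] at key
    have h1 := (ennreal_geom_mean_le_arith_mean hp hq hpq _ _).trans key
    have h2 := h1.trans (lintegral_mono fun x => min_le_left (h x / c) 1)
    simp only [div_eq_mul_inv] at h2
    rw [lintegral_mul_const _ hf, lintegral_mul_const _ hg, lintegral_mul_const _ hh,
      ENNReal.mul_rpow_of_nonneg _ _ hp.le, ENNReal.mul_rpow_of_nonneg _ _ hq.le,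
      mul_mul_mul_comm, ENNReal.inv_rpow, ENNReal.inv_rpow, ← ENNReal.mul_inv, ← hc] at h2
    · exact (ENNReal.mul_le_mul_iff_left (ENNReal.inv_ne_zero.2 hct)
        (ENNReal.inv_ne_top.2 hc0)).1 h2
    · left; simp [ENNReal.rpow_eq_zero_iff, ha0, hft]
    · left; exact ENNReal.rpow_ne_top_of_nonneg hp.le hft
  · intro s x y hs1 hs2
    by_cases hs0 : s < 0
    · exact hs0.trans_le ENNReal.toReal_nonneg
    rw [← ENNReal.ofReal_lt_iff_lt_toReal (not_lt.1 hs0) (fnt x)] at hs1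
    rw [← ENNReal.ofReal_lt_iff_lt_toReal (not_lt.1 hs0) (gnt y)] at hs2
    rw [← ENNReal.ofReal_lt_iff_lt_toReal (not_lt.1 hs0) (hnt _)]
    refine lt_min ?_ (hs1.trans_le (fl x))
    calc ENNReal.ofReal s = ENNReal.ofReal s ^ p * ENNReal.ofReal s ^ q := by
          rw [← ENNReal.rpow_add_of_nonneg _ _ hp.le hq.le, hpq, ENNReal.rpow_one]
      _ < (f x / a) ^ p * (g y / b) ^ q :=
          ENNReal.mul_lt_mul (ENNReal.rpow_lt_rpow hs1 hp) (ENNReal.rpow_lt_rpow hs2 hq)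
      _ = f x ^ p * g y ^ q / c := by
          rw [ENNReal.div_rpow_of_nonneg _ _ hp.le, ENNReal.div_rpow_of_nonneg _ _ hq.le, hc]
          simp only [div_eq_mul_inv]
          rw [ENNReal.mul_inv, mul_mul_mul_comm]
          · left; simp [ENNReal.rpow_eq_zero_iff, ha0, hft]
          · left; exact ENNReal.rpow_ne_top_of_nonneg hp.le hft
      _ ≤ _ := by gcongr; exact H x y

/-- The one-dimensional Prékopa-Leindler inequality. -/
theorem prekopa_leindler_one_dim {f g h : ℝ → ℝ≥0∞} {p q : ℝ} (hp : 0 < p) (hq : 0 < q)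
    (hpq : p + q = 1) (hf : Measurable f) (hg : Measurable g) (hh : Measurable h)
    (H : ∀ x y, f x ^ p * g y ^ q ≤ h (p * x + q * y)) :
    (∫⁻ x, f x) ^ p * (∫⁻ x, g x) ^ q ≤ ∫⁻ x, h x := by
  have trunc : ∀ F : ℝ → ℝ≥0∞, Measurable F → ∀ r : ℝ, 0 < r →
      (∫⁻ x, F x) ^ r = ⨆ m : ℕ, (∫⁻ x, min (F x) m) ^ r := by
    intro F hF r hr
    have h1 : ∀ x, F x = ⨆ m : ℕ, min (F x) m := fun x => by
      rw [← inf_iSup_eq, ENNReal.iSup_natCast, inf_top_eq]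
    have h2 : ∫⁻ x, F x = ⨆ m : ℕ, ∫⁻ x, min (F x) m := by
      rw [← lintegral_iSup (f := fun (m : ℕ) x => min (F x) m) (fun m => by fun_prop)
        (fun m k hmk x => min_le_min_left _ (by exact_mod_cast hmk))]
      exact lintegral_congr h1
    rw [h2]
    exact (ENNReal.orderIsoRpow r hr).map_iSup _
  rw [trunc f hf p hp, trunc g hg q hq]
  simp only [ENNReal.iSup_mul, ENNReal.mul_iSup]
  refine iSup₂_le fun k m => ?_
  have bdd : ∀ (F : ℝ → ℝ≥0∞) (m : ℕ), ⨆ x, min (F x) m ≠ ∞ := fun F m =>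
    ne_top_of_le_ne_top (ENNReal.natCast_ne_top m) (iSup_le fun x => min_le_right _ _)
  refine prekopa_leindler_one_dim_bounded hp hq hpq (by fun_prop) (by fun_prop) hh
    (bdd f m) (bdd g k) fun x y => le_trans ?_ (H x y)
  gcongr
  · exact min_le_left _ _
  · exact min_le_left _ _

/-- The Prékopa-Leindler inequality. -/
theorem prekopa_leindler {p q : ℝ} (hp : 0 < p) (hq : 0 < q) (hpq : p + q = 1) (n : ℕ)
    {f g h : (Fin n → ℝ) → ℝ≥0∞} (hf : Measurable f) (hg : Measurable g) (hh : Measurable h)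
    (H : ∀ x y, f x ^ p * g y ^ q ≤ h (p • x + q • y)) :
    (∫⁻ x, f x) ^ p * (∫⁻ x, g x) ^ q ≤ ∫⁻ x, h x := by
  induction n with
  | zero =>
    simp only [volume_pi, Measure.pi_of_empty _ (0 : Fin 0 → ℝ), lintegral_dirac]
    simpa using H 0 0
  | succ n ih =>
    let e := MeasurableEquiv.piFinSuccAbove (fun _ : Fin (n + 1) => ℝ) 0
    have fub : ∀ F : (Fin (n + 1) → ℝ) → ℝ≥0∞, Measurable F →
        ∫⁻ x, F x = ∫⁻ a, ∫⁻ z, F (e.symm (a, z)) := by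
      intro F hF
      rw [← (volume_preserving_piFinSuccAbove (fun _ : Fin (n + 1) => ℝ) 0).symm.lintegral_comp hF,
        Measure.volume_eq_prod, lintegral_prod _ (by fun_prop)]
    have mble : ∀ F : (Fin (n + 1) → ℝ) → ℝ≥0∞, Measurable F →
        Measurable fun a => ∫⁻ z, F (e.symm (a, z)) := fun F hF =>
      Measurable.lintegral_prod_right' (f := fun w => F (e.symm w)) (by fun_prop)
    rw [fub f hf, fub g hg, fub h hh]
    refine prekopa_leindler_one_dim hp hq hpq (mble f hf) (mble g hg) (mble h hh) fun a b => ?_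
    refine ih (by fun_prop) (by fun_prop) (by fun_prop) fun x y => ?_
    refine (H _ _).trans_eq ?_
    congr 1
    ext i
    refine Fin.cases ?_ (fun i => ?_) i <;> simp [e]


theorem prekopa_leindler_sets {n : ℕ} {p q : ℝ} (hp : 0 < p) (hq : 0 < q) (hpq : p + q = 1)
    {A B C : Set (EuclideanSpace ℝ (Fin n))} (hA : MeasurableSet A) (hB : MeasurableSet B)
    (hC : MeasurableSet C) (H : ∀ x ∈ A, ∀ y ∈ B, p • x + q • y ∈ C) :
    volume A ^ p * volume B ^ q ≤ volume C := by
  have ind : ∀ S : Set (EuclideanSpace ℝ (Fin n)), MeasurableSet S →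
      volume S = ∫⁻ z, S.indicator 1 (WithLp.toLp 2 z) := by
    intro S hS
    rw [(PiLp.volume_preserving_toLp (Fin n)).lintegral_comp (measurable_one.indicator hS),
      lintegral_indicator_one hS]
  have hmeas : ∀ S : Set (EuclideanSpace ℝ (Fin n)), MeasurableSet S →
      Measurable fun z : Fin n → ℝ => S.indicator (1 : EuclideanSpace ℝ (Fin n) → ℝ≥0∞) (WithLp.toLp 2 z) :=
    fun S hS => (measurable_one.indicator hS).comp (WithLp.measurable_toLp 2 _)
  rw [ind A hA, ind B hB, ind C hC]
  refine prekopa_leindler hp hq hpq n (hmeas A hA) (hmeas B hB) (hmeas C hC) fun x y => ?_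
  by_cases hx : WithLp.toLp 2 x ∈ A
  · by_cases hy : WithLp.toLp 2 y ∈ B
    · have := H _ hx _ hy
      simp [hx, hy, this]
    · simp [hy, hq]
  · simp [hx, hp]

/-- Brunn-Minkowski inequality for the sum of a set and a ball. -/
theorem volume_ball_le_volume_add_ball {n : ℕ} {A : Set (EuclideanSpace ℝ (Fin n))}
    (hA : MeasurableSet A) {r ε : ℝ} (hr : 0 < r) (hε : 0 < ε)
    (h : volume A = volume (Metric.ball (0 : EuclideanSpace ℝ (Fin n)) r)) :
    volume (Metric.ball (0 : EuclideanSpace ℝ (Fin n)) (r + ε)) ≤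
      volume (A + Metric.ball (0 : EuclideanSpace ℝ (Fin n)) ε) := by
  have hs : 0 < r + ε := by positivity
  have hp : 0 < r / (r + ε) := by positivity
  have hq : 0 < ε / (r + ε) := by positivity
  have hpq : r / (r + ε) + ε / (r + ε) = 1 := by field_simp
  have h1 : volume (((r + ε) / r) • A) =
      volume (Metric.ball (0 : EuclideanSpace ℝ (Fin n)) (r + ε)) := by
    have h2 : Metric.ball (0 : EuclideanSpace ℝ (Fin n)) (r + ε) =
        ((r + ε) / r) • Metric.ball (0 : EuclideanSpace ℝ (Fin n)) r := by
      rw [smul_ball (by positivity), smul_zero, Real.norm_of_nonneg (by positivity)]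
      congr 1
      field_simp
    rw [h2, Measure.addHaar_smul, Measure.addHaar_smul, h]
  have key := prekopa_leindler_sets (A := ((r + ε) / r) • A)
    (B := Metric.ball (0 : EuclideanSpace ℝ (Fin n)) (r + ε))
    (C := A + Metric.ball (0 : EuclideanSpace ℝ (Fin n)) ε) hp hq hpq
    (hA.const_smul₀ _) measurableSet_ball (Metric.isOpen_ball.add_left).measurableSet ?_
  · rwa [h1, ← ENNReal.rpow_add_of_nonneg _ _ hp.le hq.le, hpq, ENNReal.rpow_one] at key
  · rintro _ ⟨x, hx, rfl⟩ y hy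
    refine Set.add_mem_add ?_ ?_
    · rw [smul_smul]
      convert hx
      rw [div_mul_div_cancel₀ hs.ne', div_self hr.ne', one_smul]
    · rw [mem_ball_zero_iff] at hy ⊢
      rw [norm_smul, Real.norm_of_nonneg hq.le]
      calc ε / (r + ε) * ‖y‖ < ε / (r + ε) * (r + ε) := by gcongr
        _ = ε := by field_simp

/-- The volume of the unit ball in `ℝ^(N+1)`. -/
noncomputable def unitBallVolume (N : ℕ) : ℝ :=
  (volume (Metric.ball (0 : EuclideanSpace ℝ (Fin (N + 1))) 1)).toReal

theorem unitBallVolume_pos (N : ℕ) : 0 < unitBallVolume N :=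
  ENNReal.toReal_pos (Metric.measure_ball_pos _ _ one_pos).ne' measure_ball_lt_top.ne

theorem volume_ball_eq (N : ℕ) {r : ℝ} (hr : 0 ≤ r) :
    volume (Metric.ball (0 : EuclideanSpace ℝ (Fin (N + 1))) r) =
      ENNReal.ofReal (unitBallVolume N * r ^ (N + 1)) := by
  rw [Measure.addHaar_ball _ _ hr, finrank_euclideanSpace_fin, mul_comm (unitBallVolume N),
    ENNReal.ofReal_mul (by positivity), unitBallVolume,
    ENNReal.ofReal_toReal measure_ball_lt_top.ne]

/-- The radius of the ball with volume equal to that of the superlevel set `{f > max t 0}`. -/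
noncomputable def levelRadius {N : ℕ} (f : EuclideanSpace ℝ (Fin (N + 1)) → ℝ) (t : ℝ) : ℝ :=
  ((volume {x | max t 0 < f x}).toReal / unitBallVolume N) ^ ((N + 1 : ℕ) : ℝ)⁻¹

section levelRadius

variable {N : ℕ} {f : EuclideanSpace ℝ (Fin (N + 1)) → ℝ} {R : ℝ}

theorem levelRadius_nonneg (t : ℝ) : 0 ≤ levelRadius f t :=
  Real.rpow_nonneg (div_nonneg ENNReal.toReal_nonneg (unitBallVolume_pos N).le) _

theorem volume_superlevel_ne_top
    (hvol : volume {x | 0 < f x} ≤ volume (Metric.ball (0 : EuclideanSpace ℝ (Fin (N + 1))) R))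
    {t : ℝ} (ht : 0 ≤ t) : volume {x | t < f x} ≠ ∞ :=
  ne_top_of_le_ne_top measure_ball_lt_top.ne
    (le_trans (measure_mono fun _ hx => lt_of_le_of_lt ht hx) hvol)

theorem volume_superlevel
    (hvol : volume {x | 0 < f x} ≤ volume (Metric.ball (0 : EuclideanSpace ℝ (Fin (N + 1))) R))
    {t : ℝ} (ht : 0 ≤ t) : volume {x | t < f x} =
      volume (Metric.ball (0 : EuclideanSpace ℝ (Fin (N + 1))) (levelRadius f t)) := by
  have h1 := volume_superlevel_ne_top hvol ht
  rw [volume_ball_eq N (levelRadius_nonneg t), levelRadius, max_eq_left ht,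
    Real.rpow_inv_natCast_pow (div_nonneg ENNReal.toReal_nonneg (unitBallVolume_pos N).le)
      (Nat.succ_ne_zero N), mul_div_cancel₀ _ (unitBallVolume_pos N).ne', ENNReal.ofReal_toReal h1]

theorem levelRadius_antitone
    (hvol : volume {x | 0 < f x} ≤ volume (Metric.ball (0 : EuclideanSpace ℝ (Fin (N + 1))) R)) :
    Antitone (levelRadius f) := by
  intro s t hst
  refine Real.rpow_le_rpow (div_nonneg ENNReal.toReal_nonneg (unitBallVolume_pos N).le) ?_
    (by positivity)
  refine div_le_div_of_nonneg_right ?_ (unitBallVolume_pos N).le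
  refine ENNReal.toReal_mono (volume_superlevel_ne_top hvol (le_max_right _ _)) ?_
  exact measure_mono fun x hx => lt_of_le_of_lt (max_le_max_right 0 hst) hx

theorem levelRadius_le (hR : 0 ≤ R)
    (hvol : volume {x | 0 < f x} ≤ volume (Metric.ball (0 : EuclideanSpace ℝ (Fin (N + 1))) R))
    (t : ℝ) : levelRadius f t ≤ R := by
  have h0 := hvol
  rw [volume_superlevel hvol le_rfl, volume_ball_eq N (levelRadius_nonneg _),
    volume_ball_eq N hR, ENNReal.ofReal_le_ofReal_iff
      (mul_nonneg (unitBallVolume_pos N).le (by positivity))] at h0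
  have h1 : levelRadius f 0 ≤ R :=
    (pow_le_pow_iff_left₀ (levelRadius_nonneg _) hR (Nat.succ_ne_zero N)).1
      (le_of_mul_le_mul_left h0 (unitBallVolume_pos N))
  have h2 : levelRadius f t = levelRadius f (max t 0) := by
    simp [levelRadius]
  rw [h2]
  exact (levelRadius_antitone hvol (le_max_right t 0)).trans h1

end levelRadius

theorem pow_succ_add_mul_le (N : ℕ) {r ε : ℝ} (hr : 0 ≤ r) (hε : 0 ≤ ε) :
    r ^ (N + 1) + (N + 1) * r ^ N * ε ≤ (r + ε) ^ (N + 1) := by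
  induction N with
  | zero => simp
  | succ N ih =>
    rw [pow_succ (r + ε)]
    have h1 : (r ^ (N + 1) + (N + 1) * r ^ N * ε) * (r + ε) ≤ (r + ε) ^ (N + 1) * (r + ε) := by
      gcongr
    refine le_trans ?_ h1
    have : 0 ≤ (N + 1) * r ^ N * ε * ε := by positivity
    push_cast
    rw [pow_succ r (N + 1), pow_succ r N]
    nlinarith

/-- Volume of the layer swept by a level set, from the Brunn-Minkowski inequality. -/
theorem le_volume_layer {N : ℕ} {f g : EuclideanSpace ℝ (Fin (N + 1)) → ℝ} {C R S t ε : ℝ}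
    (hf : Continuous f) (hg0 : ∀ x, 0 ≤ g x) (hC : 0 ≤ C)
    (hfg : ∀ x y, f y ≤ f x + g x * ‖y - x‖ + C * ‖y - x‖ ^ 2)
    (hsupp : ∀ x, S ≤ ‖x‖ → f x = 0)
    (hvol : volume {x | 0 < f x} ≤ volume (Metric.ball (0 : EuclideanSpace ℝ (Fin (N + 1))) R))
    (ht : 0 ≤ t) (hρ : 0 < levelRadius f t) (hε : 0 < ε) (hε1 : ε ≤ 1) :
    ENNReal.ofReal ((N + 1) * unitBallVolume N * levelRadius f t ^ N * ε) ≤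
      volume {x | x ∈ Metric.ball 0 (S + 1) ∧ f x ≤ t ∧ t < f x + g x * ε + C * ε ^ 2} := by
  have hω := unitBallVolume_pos N
  set ρ := levelRadius f t
  set A := {x | t < f x} with hA
  have hAo : IsOpen A := isOpen_lt continuous_const hf
  have hAv := volume_superlevel hvol ht
  have h1 := volume_ball_le_volume_add_ball hAo.measurableSet hρ hε hAv
  have h2 : volume (A + Metric.ball (0 : EuclideanSpace ℝ (Fin (N + 1))) ε) - volume A ≤
      volume ((A + Metric.ball (0 : EuclideanSpace ℝ (Fin (N + 1))) ε) \ A) := le_measure_sdiff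
  calc ENNReal.ofReal ((N + 1) * unitBallVolume N * ρ ^ N * ε)
      ≤ ENNReal.ofReal (unitBallVolume N * (ρ + ε) ^ (N + 1) -
          unitBallVolume N * ρ ^ (N + 1)) := by
        refine ENNReal.ofReal_le_ofReal ?_
        have := mul_le_mul_of_nonneg_left (pow_succ_add_mul_le N hρ.le hε.le) hω.le
        linarith
    _ = volume (Metric.ball (0 : EuclideanSpace ℝ (Fin (N + 1))) (ρ + ε)) - volume A := by
        rw [hAv, volume_ball_eq N (by positivity), volume_ball_eq N hρ.le,
          ENNReal.ofReal_sub _ (by positivity)]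
    _ ≤ volume (A + Metric.ball (0 : EuclideanSpace ℝ (Fin (N + 1))) ε) - volume A := by gcongr
    _ ≤ _ := h2
    _ ≤ _ := by
        refine measure_mono ?_
        rintro _ ⟨⟨a, ha, b, hb, rfl⟩, hz⟩
        rw [mem_ball_zero_iff] at hb
        have ha' : t < f a := ha
        refine ⟨?_, not_lt.1 hz, ?_⟩
        · have h3 : ‖a‖ < S := by
            by_contra! h
            have := hsupp a h
            linarith
          rw [mem_ball_zero_iff]
          exact (norm_add_le a b).trans_lt (by linarith)
        · have h4 := hfg (a + b) a
          have h5 : ‖a - (a + b)‖ = ‖b‖ := by simp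
          rw [h5] at h4
          calc t < _ := ha'
            _ ≤ _ := h4
            _ ≤ _ := by
              have := hg0 (a + b)
              gcongr

theorem measure_le_of_forall_measure_level_le {α : Type*} [MeasurableSpace α] {μ : Measure α}
    {f : α → ℝ} {D : Set α} {t : ℝ} {M : ℝ≥0∞} (hbdd : BddAbove (f '' D))
    (hD : ∀ x ∈ D, t < f x) (h : ∀ x ∈ D, μ {y | t < f y ∧ f y ≤ f x} ≤ M) : μ D ≤ M := by
  rcases D.eq_empty_or_nonempty with rfl | hne
  · simp
  have hlub := isLUB_csSup (hne.image f) hbdd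
  set s := sSup (f '' D)
  by_cases hs : ∃ x ∈ D, f x = s
  · obtain ⟨x, hx, hxs⟩ := hs
    refine (measure_mono fun y hy => ?_).trans (h x hx)
    exact ⟨hD y hy, hxs ▸ hlub.1 ⟨y, hy, rfl⟩⟩
  · push Not at hs
    obtain ⟨u, hu, -, hlim, hmem⟩ := hlub.exists_seq_monotone_tendsto (hne.image f)
    have hsub : D ⊆ ⋃ n, {y | t < f y ∧ f y ≤ u n} := by
      intro y hy
      have hlt : f y < s := lt_of_le_of_ne (hlub.1 ⟨y, hy, rfl⟩) (hs y hy)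
      obtain ⟨n, hn⟩ := (hlim.eventually (lt_mem_nhds hlt)).exists
      exact Set.mem_iUnion.2 ⟨n, hD y hy, hn.le⟩
    refine (measure_mono hsub).trans ?_
    rw [Monotone.measure_iUnion]
    · refine iSup_le fun n => ?_
      obtain ⟨x, hx, hxu⟩ := hmem n
      rw [← hxu]
      exact h x hx
    · intro m n hmn y hy
      exact ⟨hy.1, hy.2.trans (hu hmn)⟩

theorem setLIntegral_superlevel_le {N : ℕ} {f : EuclideanSpace ℝ (Fin (N + 1)) → ℝ} {R t B : ℝ}
    (hf : Continuous f) (hfB : ∀ x, f x ≤ B)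
    (hvol : volume {x | 0 < f x} ≤ volume (Metric.ball (0 : EuclideanSpace ℝ (Fin (N + 1))) R))
    (ht : 0 ≤ t) {K : ℝ → ℝ} (hK : Monotone K) (hK0 : ∀ r, 0 ≤ K r) :
    ∫⁻ x in {x | t < f x}, ENNReal.ofReal (K (levelRadius f (f x))) ≤
      ∫⁻ y in Metric.ball (0 : EuclideanSpace ℝ (Fin (N + 1))) (levelRadius f t),
        ENNReal.ofReal (K ‖y‖) := by
  have hρm := (levelRadius_antitone hvol).measurable
  have hm1 : Measurable fun x => K (levelRadius f (f x)) :=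
    hK.measurable.comp (hρm.comp hf.measurable)
  have hm2 : Measurable fun y : EuclideanSpace ℝ (Fin (N + 1)) => K ‖y‖ :=
    hK.measurable.comp measurable_norm
  rw [lintegral_eq_lintegral_meas_lt _ (.of_forall fun _ => hK0 _) hm1.aemeasurable,
    lintegral_eq_lintegral_meas_lt _ (.of_forall fun _ => hK0 _) hm2.aemeasurable]
  refine lintegral_mono fun c => ?_
  rw [Measure.restrict_apply (measurableSet_lt measurable_const hm1),
    Measure.restrict_apply (measurableSet_lt measurable_const hm2)]
  refine measure_le_of_forall_measure_level_le (f := f) (t := t) ⟨B, ?_⟩ (fun x hx => hx.2) ?_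
  · rintro _ ⟨x, -, rfl⟩
    exact hfB x
  · rintro x ⟨hx1, hx2⟩
    have hx2' : t < f x := hx2
    have e1 : {y | t < f y ∧ f y ≤ f x} = {y | t < f y} \ {y | f x < f y} := by
      ext y; simp
    have hfx : 0 ≤ f x := ht.trans hx2'.le
    have hle := levelRadius_antitone hvol hx2'.le
    calc volume {y | t < f y ∧ f y ≤ f x}
        = volume {y | t < f y} - volume {y | f x < f y} := by
          rw [e1]
          refine measure_sdiff (fun y hy => hx2'.trans hy) ?_ (volume_superlevel_ne_top hvol hfx)
          exact (isOpen_lt continuous_const hf).measurableSet.nullMeasurableSet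
      _ = volume (Metric.ball (0 : EuclideanSpace ℝ (Fin (N + 1))) (levelRadius f t)) -
          volume (Metric.ball (0 : EuclideanSpace ℝ (Fin (N + 1))) (levelRadius f (f x))) := by
          rw [volume_superlevel hvol ht, volume_superlevel hvol hfx]
      _ ≤ _ := le_measure_sdiff
      _ ≤ _ := by
          refine measure_mono ?_
          rintro y ⟨hy1, hy2⟩
          refine ⟨?_, hy1⟩
          rw [mem_ball_zero_iff, not_lt] at hy2
          exact lt_of_lt_of_le hx1 (hK hy2)

theorem lintegral_sq_mul_le {N : ℕ} {f : EuclideanSpace ℝ (Fin (N + 1)) → ℝ} {R B : ℝ}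
    (hf : Continuous f) (hf0 : ∀ x, 0 ≤ f x) (hfB : ∀ x, f x ≤ B)
    (hvol : volume {x | 0 < f x} ≤ volume (Metric.ball (0 : EuclideanSpace ℝ (Fin (N + 1))) R))
    {K : ℝ → ℝ} (hK : Monotone K) (hK0 : ∀ r, 0 ≤ K r) :
    ∫⁻ x, ENNReal.ofReal (f x ^ 2 * K (levelRadius f (f x))) ≤
      ∫⁻ t in Set.Ioi (0 : ℝ), ENNReal.ofReal (2 * t) *
        ∫⁻ y in Metric.ball (0 : EuclideanSpace ℝ (Fin (N + 1))) (levelRadius f t),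
          ENNReal.ofReal (K ‖y‖) := by
  have hm1 : Measurable fun x => ENNReal.ofReal (K (levelRadius f (f x))) :=
    (hK.measurable.comp ((levelRadius_antitone hvol).measurable.comp hf.measurable)).ennreal_ofReal
  have h1 := lintegral_rpow_eq_lintegral_meas_lt_mul
    (volume.withDensity fun x => ENNReal.ofReal (K (levelRadius f (f x))))
    (.of_forall hf0) hf.measurable.aemeasurable (p := 2) two_pos
  rw [lintegral_withDensity_eq_lintegral_mul _ hm1 (by fun_prop)] at h1
  have h2 : ∫⁻ x, ENNReal.ofReal (f x ^ 2 * K (levelRadius f (f x))) =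
      ∫⁻ x, ((fun x => ENNReal.ofReal (K (levelRadius f (f x)))) *
        fun x => ENNReal.ofReal (f x ^ (2 : ℝ))) x := by
    refine lintegral_congr fun x => ?_
    rw [Pi.mul_apply, Real.rpow_two, mul_comm, ENNReal.ofReal_mul (hK0 _)]
  rw [h2, h1, ← lintegral_const_mul']
  · refine setLIntegral_mono' measurableSet_Ioi fun t ht => ?_
    have ht' : 0 ≤ t := le_of_lt ht
    rw [withDensity_apply _ (isOpen_lt continuous_const hf).measurableSet,
      ENNReal.ofReal_mul zero_le_two, mul_assoc]
    refine mul_le_mul' le_rfl ?_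
    rw [mul_comm]
    refine mul_le_mul' (by norm_num) (setLIntegral_superlevel_le hf hfB hvol ht' hK hK0)
  · simp

theorem lintegral_level_perimeter_mul_le {N : ℕ} {f g : EuclideanSpace ℝ (Fin (N + 1)) → ℝ}
    {C R S B G M ε : ℝ} (hf : Continuous f) (hf0 : ∀ x, 0 ≤ f x) (hfB : ∀ x, f x ≤ B)
    (hg : Continuous g) (hg0 : ∀ x, 0 ≤ g x) (hgG : ∀ x, g x ≤ G) (hC : 0 ≤ C)
    (hfg : ∀ x y, f y ≤ f x + g x * ‖y - x‖ + C * ‖y - x‖ ^ 2)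
    (hsupp : ∀ x, S ≤ ‖x‖ → f x = 0)
    (hvol : volume {x | 0 < f x} ≤ volume (Metric.ball (0 : EuclideanSpace ℝ (Fin (N + 1))) R))
    {κ : ℝ → ℝ} (hκ : Antitone κ) (hκ0 : ∀ t, 0 ≤ κ t) (hκM : ∀ t, κ t ≤ M)
    (hκρ : ∀ t, κ t ≠ 0 → 0 < levelRadius f t) (hε : 0 < ε) (hε1 : ε ≤ 1) :
    ENNReal.ofReal ε * (∫⁻ t in Set.Ioi (0 : ℝ), ENNReal.ofReal (2 * t) *
        ENNReal.ofReal ((N + 1) * unitBallVolume N * levelRadius f t ^ N * κ t)) ≤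
      ENNReal.ofReal ε * ((∫⁻ x, ENNReal.ofReal (2 * f x * κ (f x) * g x)) +
        ENNReal.ofReal ε * (ENNReal.ofReal (2 * M * (B * C + G ^ 2 + 2 * G * C + C ^ 2)) *
          volume (Metric.ball (0 : EuclideanSpace ℝ (Fin (N + 1))) (S + 1)))) := by
  have hω := unitBallVolume_pos N
  set b := Metric.ball (0 : EuclideanSpace ℝ (Fin (N + 1))) (S + 1) with hb
  set T : Set (ℝ × EuclideanSpace ℝ (Fin (N + 1))) :=
    {w | w.2 ∈ b ∧ f w.2 ≤ w.1 ∧ w.1 < f w.2 + g w.2 * ε + C * ε ^ 2} with hT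
  have hTm : MeasurableSet T := by
    refine (measurable_snd measurableSet_ball).inter (MeasurableSet.inter ?_ ?_)
    · exact measurableSet_le (hf.measurable.comp measurable_snd) measurable_fst
    · exact measurableSet_lt measurable_fst
        ((((hf.add (hg.mul continuous_const)).add continuous_const).measurable).comp measurable_snd)
  have hκm : Measurable κ := hκ.measurable
  have hwm : Measurable fun t : ℝ => ENNReal.ofReal (2 * t * κ t) := by fun_prop
  calc ENNReal.ofReal ε * (∫⁻ t in Set.Ioi (0 : ℝ), ENNReal.ofReal (2 * t) *
        ENNReal.ofReal ((N + 1) * unitBallVolume N * levelRadius f t ^ N * κ t))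
      = ∫⁻ t in Set.Ioi (0 : ℝ), ENNReal.ofReal ε * (ENNReal.ofReal (2 * t) *
        ENNReal.ofReal ((N + 1) * unitBallVolume N * levelRadius f t ^ N * κ t)) := by
        rw [lintegral_const_mul' _ _ ENNReal.ofReal_ne_top]
    _ ≤ ∫⁻ t in Set.Ioi (0 : ℝ), ENNReal.ofReal (2 * t * κ t) * volume {x | (t, x) ∈ T} := by
        refine setLIntegral_mono' measurableSet_Ioi fun t ht => ?_
        have ht' : 0 < t := ht
        by_cases hk : κ t = 0
        · simp [hk]
        have hle := le_volume_layer hf hg0 hC hfg hsupp hvol ht'.le (hκρ t hk) hε hε1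
        have hρ0 := (hκρ t hk).le
        have hk0 := hκ0 t
        refine le_trans (le_of_eq ?_) (mul_le_mul' le_rfl hle)
        rw [← ENNReal.ofReal_mul (by positivity), ← ENNReal.ofReal_mul (by positivity),
          ← ENNReal.ofReal_mul (by positivity)]
        congr 1
        ring
    _ = ∫⁻ t in Set.Ioi (0 : ℝ), ∫⁻ x, T.indicator
          (fun w => ENNReal.ofReal (2 * w.1 * κ w.1)) (t, x) := by
        refine setLIntegral_congr_fun measurableSet_Ioi fun t _ => ?_
        have : (fun x => T.indicator (fun w => ENNReal.ofReal (2 * w.1 * κ w.1)) (t, x)) =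
            {x | (t, x) ∈ T}.indicator fun _ => ENNReal.ofReal (2 * t * κ t) := by
          ext x; simp [Set.indicator]
        simp only [this]
        exact (lintegral_indicator_const
          (measurable_prodMk_left hTm : MeasurableSet {x | (t, x) ∈ T}) _).symm
    _ = ∫⁻ x, ∫⁻ t in Set.Ioi (0 : ℝ), T.indicator
          (fun w => ENNReal.ofReal (2 * w.1 * κ w.1)) (t, x) := by
        refine lintegral_lintegral_swap (Measurable.aemeasurable ?_)
        exact Measurable.indicator (by fun_prop) hTm
    _ ≤ ∫⁻ x, b.indicator (fun x => ENNReal.ofReal ε * (ENNReal.ofReal (2 * f x * κ (f x) * g x) +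
          ENNReal.ofReal ε * ENNReal.ofReal (2 * M * (B * C + G ^ 2 + 2 * G * C + C ^ 2)))) x := by
        refine lintegral_mono fun x => ?_
        by_cases hx : x ∈ b
        swap
        · rw [Set.indicator_of_notMem hx, nonpos_iff_eq_zero]
          convert lintegral_zero with t
          exact Set.indicator_of_notMem (fun h => hx h.1) _
        rw [Set.indicator_of_mem hx]
        set d := g x * ε + C * ε ^ 2 with hd
        have hgx := hg0 x
        have hfx := hf0 x
        have hkx := hκ0 (f x)
        have hd0 : 0 ≤ d := by positivity
        calc ∫⁻ t in Set.Ioi (0 : ℝ), T.indicator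
              (fun w => ENNReal.ofReal (2 * w.1 * κ w.1)) (t, x)
            ≤ ∫⁻ t, (Set.Ico (f x) (f x + d)).indicator
              (fun _ => ENNReal.ofReal (2 * (f x + d) * κ (f x))) t := by
              refine (setLIntegral_le_lintegral _ _).trans (lintegral_mono fun t => ?_)
              by_cases htx : (t, x) ∈ T
              · have h1 : f x ≤ t := htx.2.1
                have h2 : t < f x + d := by
                  have : t < f x + g x * ε + C * ε ^ 2 := htx.2.2
                  linarith
                rw [Set.indicator_of_mem htx, Set.indicator_of_mem (Set.mem_Ico.2 ⟨h1, h2⟩)]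
                refine ENNReal.ofReal_le_ofReal ?_
                have h3 := hκ h1
                have h4 := hκ0 t
                dsimp only
                gcongr
              · rw [Set.indicator_of_notMem htx]
                exact bot_le
          _ = ENNReal.ofReal (2 * (f x + d) * κ (f x)) * ENNReal.ofReal d := by
              rw [lintegral_indicator_const measurableSet_Ico, Real.volume_Ico]
              congr 2
              ring
          _ ≤ _ := by
              have hM : 0 ≤ M := hkx.trans (hκM _)
              have hB : 0 ≤ B := hfx.trans (hfB x)
              have hG : 0 ≤ G := hgx.trans (hgG x)
              rw [← ENNReal.ofReal_mul (by positivity), ← ENNReal.ofReal_mul hε.le,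
                ← ENNReal.ofReal_add (by positivity) (by positivity), ← ENNReal.ofReal_mul hε.le]
              refine ENNReal.ofReal_le_ofReal ?_
              have h1 : 2 * (f x + d) * κ (f x) * d = ε * (2 * f x * κ (f x) * g x + ε *
                  (2 * κ (f x) * (f x * C + g x ^ 2 + 2 * g x * C * ε + C ^ 2 * ε ^ 2))) := by
                rw [hd]; ring
              rw [h1]
              have h2 : 2 * g x * C * ε ≤ 2 * G * C := by
                calc 2 * g x * C * ε ≤ 2 * G * C * 1 := by
                      gcongr
                      exact hgG x
                  _ = _ := mul_one _
              have h3 : C ^ 2 * ε ^ 2 ≤ C ^ 2 :=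
                mul_le_of_le_one_right (by positivity) (pow_le_one₀ hε.le hε1)
              have h4 := hκM (f x)
              have h5 := hfB x
              have h6 := hgG x
              gcongr
    _ = ENNReal.ofReal ε * ((∫⁻ x in b, ENNReal.ofReal (2 * f x * κ (f x) * g x)) +
        ENNReal.ofReal ε * (ENNReal.ofReal (2 * M * (B * C + G ^ 2 + 2 * G * C + C ^ 2)) *
          volume b)) := by
        rw [lintegral_indicator measurableSet_ball, lintegral_const_mul' _ _ ENNReal.ofReal_ne_top,
          lintegral_add_right _ measurable_const, setLIntegral_const, mul_assoc]
    _ ≤ _ := by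
        gcongr
        exact Measure.restrict_le_self

theorem lintegral_level_perimeter_le {N : ℕ} {f g : EuclideanSpace ℝ (Fin (N + 1)) → ℝ}
    {C R S B G M : ℝ} (hf : Continuous f) (hf0 : ∀ x, 0 ≤ f x) (hfB : ∀ x, f x ≤ B)
    (hg : Continuous g) (hg0 : ∀ x, 0 ≤ g x) (hgG : ∀ x, g x ≤ G) (hC : 0 ≤ C)
    (hfg : ∀ x y, f y ≤ f x + g x * ‖y - x‖ + C * ‖y - x‖ ^ 2)
    (hsupp : ∀ x, S ≤ ‖x‖ → f x = 0)
    (hvol : volume {x | 0 < f x} ≤ volume (Metric.ball (0 : EuclideanSpace ℝ (Fin (N + 1))) R))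
    {κ : ℝ → ℝ} (hκ : Antitone κ) (hκ0 : ∀ t, 0 ≤ κ t) (hκM : ∀ t, κ t ≤ M)
    (hκρ : ∀ t, κ t ≠ 0 → 0 < levelRadius f t) :
    (∫⁻ t in Set.Ioi (0 : ℝ), ENNReal.ofReal (2 * t) *
        ENNReal.ofReal ((N + 1) * unitBallVolume N * levelRadius f t ^ N * κ t)) ≤
      ∫⁻ x, ENNReal.ofReal (2 * f x * κ (f x) * g x) := by
  set I := ∫⁻ x, ENNReal.ofReal (2 * f x * κ (f x) * g x)
  set D := ENNReal.ofReal (2 * M * (B * C + G ^ 2 + 2 * G * C + C ^ 2)) *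
          volume (Metric.ball (0 : EuclideanSpace ℝ (Fin (N + 1))) (S + 1)) with hD
  have hDt : D ≠ ∞ := ENNReal.mul_ne_top ENNReal.ofReal_ne_top measure_ball_lt_top.ne
  have hlim : Filter.Tendsto (fun m : ℕ => I + ENNReal.ofReal (1 / ((m : ℝ) + 1)) * D)
      Filter.atTop (nhds (I + ENNReal.ofReal 0 * D)) := by
    refine Filter.Tendsto.const_add _ (ENNReal.Tendsto.mul_const ?_ (.inr hDt))
    exact ENNReal.tendsto_ofReal tendsto_one_div_add_atTop_nhds_zero_nat
  rw [ENNReal.ofReal_zero, zero_mul, add_zero] at hlim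
  refine ge_of_tendsto' hlim fun m => ?_
  have hm : (0 : ℝ) < 1 / ((m : ℝ) + 1) := by positivity
  have hm1 : 1 / ((m : ℝ) + 1) ≤ 1 := by
    rw [div_le_one (by positivity)]
    linarith [(Nat.cast_nonneg m : (0 : ℝ) ≤ m)]
  have := lintegral_level_perimeter_mul_le hf hf0 hfB hg hg0 hgG hC hfg hsupp hvol hκ hκ0 hκM hκρ
    hm hm1
  exact (ENNReal.mul_le_mul_iff_right (ENNReal.ofReal_pos.2 hm).ne' ENNReal.ofReal_ne_top).1 this

/-- A comparison principle: a radial solution `k` of the Riccati equation on a ball of the same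
volume as `{f > 0}` yields a lower bound on the Dirichlet energy. -/
theorem mul_lintegral_sq_le {N : ℕ} {f g : EuclideanSpace ℝ (Fin (N + 1)) → ℝ}
    {C R S B G Λ : ℝ} (hf : Continuous f) (hf0 : ∀ x, 0 ≤ f x) (hfB : ∀ x, f x ≤ B)
    (hg : Continuous g) (hg0 : ∀ x, 0 ≤ g x) (hgG : ∀ x, g x ≤ G) (hC : 0 ≤ C)
    (hfg : ∀ x y, f y ≤ f x + g x * ‖y - x‖ + C * ‖y - x‖ ^ 2)
    (hsupp : ∀ x, S ≤ ‖x‖ → f x = 0) (hR : 0 ≤ R)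
    (hvol : volume {x | 0 < f x} ≤ volume (Metric.ball (0 : EuclideanSpace ℝ (Fin (N + 1))) R))
    {k : ℝ → ℝ} (hk : Monotone k) (hk0 : ∀ r ≤ 0, k r = 0) (hΛ : 0 ≤ Λ)
    (hkint : ∀ r, 0 ≤ r → r ≤ R →
      ∫⁻ y in Metric.ball (0 : EuclideanSpace ℝ (Fin (N + 1))) r,
        ENNReal.ofReal (k ‖y‖ ^ 2 + Λ) ≤
          ENNReal.ofReal ((N + 1) * unitBallVolume N * r ^ N * k r)) :
    ENNReal.ofReal Λ * (∫⁻ x, ENNReal.ofReal (f x ^ 2)) ≤ ∫⁻ x, ENNReal.ofReal (g x ^ 2) := by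
  have hkn : ∀ r, 0 ≤ k r := fun r => by
    rcases le_total r 0 with h | h
    · exact (hk0 r h).ge
    · exact (hk0 0 le_rfl).ge.trans (hk h)
  set κ : ℝ → ℝ := fun t => k (levelRadius f t) with hκdef
  have hκ : Antitone κ := fun s t hst => hk (levelRadius_antitone hvol hst)
  have hκM : ∀ t, κ t ≤ k R := fun t => hk (levelRadius_le hR hvol t)
  have hκρ : ∀ t, κ t ≠ 0 → 0 < levelRadius f t := fun t ht => by
    by_contra! h
    exact ht (hk0 _ h)
  have hKmono : Monotone fun r => k r ^ 2 + Λ := fun r s hrs => by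
    have := hk hrs
    have := hkn r
    dsimp only
    gcongr
  have hA := lintegral_level_perimeter_le hf hf0 hfB hg hg0 hgG hC hfg hsupp hvol hκ
    (fun t => hkn _) hκM hκρ
  have hB := lintegral_sq_mul_le hf hf0 hfB hvol hKmono fun r => by positivity
  have hBA : ∫⁻ x, ENNReal.ofReal (f x ^ 2 * (κ (f x) ^ 2 + Λ)) ≤
      ∫⁻ x, ENNReal.ofReal (2 * f x * κ (f x) * g x) := by
    refine hB.trans (le_trans ?_ hA)
    refine lintegral_mono fun t => mul_le_mul' le_rfl ?_
    exact hkint _ (levelRadius_nonneg t) (levelRadius_le hR hvol t)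
  have hκm : Measurable fun x => κ (f x) := hκ.measurable.comp hf.measurable
  have hfin : ∫⁻ x, ENNReal.ofReal (f x ^ 2 * κ (f x) ^ 2) ≠ ∞ := by
    have hle : ∀ x, ENNReal.ofReal (f x ^ 2 * κ (f x) ^ 2) ≤
        (Metric.ball (0 : EuclideanSpace ℝ (Fin (N + 1))) S).indicator
          (fun _ => ENNReal.ofReal (B ^ 2 * k R ^ 2)) x := by
      intro x
      by_cases hx : x ∈ Metric.ball (0 : EuclideanSpace ℝ (Fin (N + 1))) S
      · rw [Set.indicator_of_mem hx]
        have h1 := hf0 x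
        have h2 := hfB x
        have h3 := hκM (f x)
        have h4 : 0 ≤ κ (f x) := hkn _
        gcongr
      · rw [mem_ball_zero_iff, not_lt] at hx
        simp [hsupp x hx]
    refine ne_top_of_le_ne_top ?_ (lintegral_mono hle)
    rw [lintegral_indicator_const measurableSet_ball]
    exact ENNReal.mul_ne_top ENNReal.ofReal_ne_top measure_ball_lt_top.ne
  have h1 : (∫⁻ x, ENNReal.ofReal (f x ^ 2 * κ (f x) ^ 2)) +
      ENNReal.ofReal Λ * (∫⁻ x, ENNReal.ofReal (f x ^ 2)) =
      ∫⁻ x, ENNReal.ofReal (f x ^ 2 * (κ (f x) ^ 2 + Λ)) := by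
    rw [← lintegral_const_mul _ (by fun_prop), ← lintegral_add_right _ (by fun_prop)]
    refine lintegral_congr fun x => ?_
    rw [← ENNReal.ofReal_mul hΛ, ← ENNReal.ofReal_add (by positivity) (by positivity)]
    congr 1
    ring
  have h2 : ∫⁻ x, ENNReal.ofReal (2 * f x * κ (f x) * g x) ≤
      (∫⁻ x, ENNReal.ofReal (f x ^ 2 * κ (f x) ^ 2)) + ∫⁻ x, ENNReal.ofReal (g x ^ 2) := by
    rw [← lintegral_add_right _ (by fun_prop)]
    refine lintegral_mono fun x => ?_
    rw [← ENNReal.ofReal_add (by positivity) (by positivity)]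
    refine ENNReal.ofReal_le_ofReal ?_
    nlinarith [sq_nonneg (f x * κ (f x) - g x)]
  exact (ENNReal.add_le_add_iff_left hfin).1 (h1.le.trans (hBA.trans h2))

/-- Coefficients of the power series `besselF`. -/
noncomputable def besselCoeff (ν : ℝ) : ℕ → ℝ
  | 0 => 1
  | k + 1 => -besselCoeff ν k / ((k + 1) * (4 * k + 2 * ν))

theorem abs_besselCoeff_le {ν : ℝ} (hν : 1 ≤ ν) (k : ℕ) :
    |besselCoeff ν k| ≤ 1 / (k.factorial : ℝ) := by
  induction k with
  | zero => simp [besselCoeff]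
  | succ k ih =>
    have h1 : (1 : ℝ) ≤ 4 * k + 2 * ν := by
      have : (0 : ℝ) ≤ k := k.cast_nonneg
      linarith
    have h0 : 0 < ((k : ℝ) + 1) * (4 * k + 2 * ν) := by positivity
    rw [besselCoeff, abs_div, abs_neg, abs_of_pos h0, Nat.factorial_succ]
    push_cast
    rw [div_le_div_iff₀ (by positivity) (by positivity)]
    have h2 : |besselCoeff ν k| * (k.factorial : ℝ) ≤ 1 := by
      rwa [le_div_iff₀ (by positivity)] at ih
    calc |besselCoeff ν k| * ((k + 1) * (k.factorial : ℝ))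
        = (k + 1) * (|besselCoeff ν k| * (k.factorial : ℝ)) := by ring
      _ ≤ (k + 1) * (4 * k + 2 * ν) := by
        gcongr
        exact h2.trans h1
      _ = _ := by ring

theorem succ_mul_besselCoeff_succ {ν : ℝ} (hν : 1 ≤ ν) (k : ℕ) :
    (k + 1) * besselCoeff ν (k + 1) = -(1 / (2 * ν)) * besselCoeff (ν + 2) k := by
  induction k with
  | zero =>
    simp [besselCoeff]
    field_simp
  | succ k ih =>
    have h1 : (4 * ((k : ℝ) + 1) + 2 * ν) ≠ 0 := by positivity
    have h2 : ((k : ℝ) + 1) ≠ 0 := by positivity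
    have h3 : ((k : ℝ) + 1 + 1) ≠ 0 := by positivity
    have h4 : besselCoeff ν (k + 1) = -(1 / (2 * ν)) * besselCoeff (ν + 2) k / (k + 1) := by
      rw [← ih]; field_simp
    rw [show besselCoeff ν (k + 1 + 1) =
      -besselCoeff ν (k + 1) / (((k + 1 : ℕ) + 1) * (4 * (k + 1 : ℕ) + 2 * ν)) from rfl,
      show besselCoeff (ν + 2) (k + 1) =
      -besselCoeff (ν + 2) k / ((k + 1) * (4 * k + 2 * (ν + 2))) from rfl, h4]
    have h5 : (4 * (k : ℝ) + 2 * (ν + 2)) ≠ 0 := by positivity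
    push_cast
    field_simp
    ring

/-- The entire function with `r ↦ besselF n (r ^ 2)` the radial solution of `Δv + v = 0`, `v 0 = 1`
in dimension `n`. -/
noncomputable def besselF (ν s : ℝ) : ℝ := ∑' k, besselCoeff ν k * s ^ k

theorem summable_besselF {ν : ℝ} (hν : 1 ≤ ν) (s : ℝ) :
    Summable fun k => besselCoeff ν k * s ^ k := by
  refine Summable.of_norm_bounded (Real.summable_pow_div_factorial |s|) fun k => ?_
  rw [norm_mul, norm_pow, Real.norm_eq_abs, Real.norm_eq_abs]
  calc |besselCoeff ν k| * |s| ^ k ≤ 1 / (k.factorial : ℝ) * |s| ^ k := by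
        gcongr
        exact abs_besselCoeff_le hν k
    _ = _ := by ring

theorem besselF_zero (ν : ℝ) : besselF ν 0 = 1 := by
  rw [besselF, tsum_eq_single 0]
  · simp [besselCoeff]
  · intro k hk
    simp [hk]

theorem hasDerivAt_besselF {ν : ℝ} (hν : 1 ≤ ν) (s : ℝ) :
    HasDerivAt (besselF ν) (-(1 / (2 * ν)) * besselF (ν + 2) s) s := by
  set M := |s| + 1
  have hb : Summable fun k : ℕ => (k : ℝ) * (1 / (k.factorial : ℝ)) * M ^ (k - 1) := by
    rw [← summable_nat_add_iff 1]
    refine (Real.summable_pow_div_factorial M).congr fun k => ?_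
    rw [Nat.factorial_succ]
    push_cast
    have : ((k : ℝ) + 1) ≠ 0 := by positivity
    field_simp
  have hd := hasDerivAt_tsum_of_isPreconnected
    (g := fun k x => besselCoeff ν k * x ^ k)
    (g' := fun k x => besselCoeff ν k * ((k : ℝ) * x ^ (k - 1)))
    hb (Metric.isOpen_ball (x := (0 : ℝ)) (ε := M)) (convex_ball _ _).isPreconnected
    (fun k y _ => (hasDerivAt_pow k y).const_mul _) (fun k y hy => ?_)
    (Metric.mem_ball_self (by positivity)) (summable_besselF hν 0)
    (y := s) (by simp [M])
  · refine HasDerivAt.congr_deriv (f := besselF ν) hd ?_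
    rw [Summable.tsum_eq_zero_add]
    · simp only [CharP.cast_eq_zero, zero_mul, mul_zero, zero_add]
      rw [besselF, ← tsum_mul_left]
      refine tsum_congr fun k => ?_
      rw [← mul_assoc (-(1 / (2 * ν))), ← succ_mul_besselCoeff_succ hν k]
      push_cast
      ring
    · rw [← summable_nat_add_iff 1]
      refine ((summable_besselF (ν := ν + 2) (by linarith) s).mul_left (-(1 / (2 * ν)))).congr
        fun k => ?_
      rw [← mul_assoc (-(1 / (2 * ν))), ← succ_mul_besselCoeff_succ hν k]
      push_cast
      ring
  · have hyM : |y| ≤ M := by simpa using (mem_ball_zero_iff.1 hy).le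
    rw [norm_mul, norm_mul, norm_pow, Real.norm_eq_abs, Real.norm_eq_abs, Real.norm_eq_abs,
      Nat.abs_cast]
    calc |besselCoeff ν k| * ((k : ℝ) * |y| ^ (k - 1))
        ≤ (1 / (k.factorial : ℝ)) * ((k : ℝ) * M ^ (k - 1)) := by
          gcongr
          exact abs_besselCoeff_le hν k
      _ = _ := by ring

theorem differentiable_besselF {ν : ℝ} (hν : 1 ≤ ν) : Differentiable ℝ (besselF ν) :=
  fun s => (hasDerivAt_besselF hν s).differentiableAt

theorem contDiff_besselF {ν : ℝ} (hν : 1 ≤ ν) : ContDiff ℝ (⊤ : ℕ∞) (besselF ν) := by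
  rw [contDiff_infty]
  intro m
  induction m generalizing ν with
  | zero => exact contDiff_zero.2 (differentiable_besselF hν).continuous
  | succ m ih =>
    rw [show ((m + 1 : ℕ) : WithTop ℕ∞) = (m : WithTop ℕ∞) + 1 by norm_cast,
      contDiff_succ_iff_deriv]
    refine ⟨differentiable_besselF hν, by simp, ?_⟩
    rw [show deriv (besselF ν) = fun s => -(1 / (2 * ν)) * besselF (ν + 2) s from
      funext fun s => (hasDerivAt_besselF hν s).deriv]
    exact contDiff_const.mul (ih (by linarith))

theorem besselF_ode {ν : ℝ} (hν : 1 ≤ ν) (s : ℝ) :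
    s * besselF (ν + 4) s / (ν * (ν + 2)) - besselF (ν + 2) s + besselF ν s = 0 := by
  have e : ∀ {μ : ℝ}, 1 ≤ μ → besselF μ s = 1 + ∑' k, besselCoeff μ (k + 1) * s ^ (k + 1) := by
    intro μ hμ
    rw [besselF, (summable_besselF hμ s).tsum_eq_zero_add]
    simp [besselCoeff]
  have hs : ∀ {μ : ℝ}, 1 ≤ μ → Summable fun k => besselCoeff μ (k + 1) * s ^ (k + 1) :=
    fun hμ => (summable_nat_add_iff 1).2 (summable_besselF hμ s)
  rw [e hν, e (by linarith : 1 ≤ ν + 2), besselF, mul_div_right_comm, ← tsum_mul_left]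
  have h4 := (summable_besselF (by linarith : 1 ≤ ν + 4) s).mul_left (s / (ν * (ν + 2)))
  have hsum := (h4.tsum_sub (hs (by linarith : 1 ≤ ν + 2)))
  have hsum2 := (h4.sub (hs (by linarith : 1 ≤ ν + 2))).tsum_add (hs hν)
  have : ∀ k : ℕ, s / (ν * (ν + 2)) * (besselCoeff (ν + 4) k * s ^ k) -
      besselCoeff (ν + 2) (k + 1) * s ^ (k + 1) + besselCoeff ν (k + 1) * s ^ (k + 1) = 0 := by
    intro k
    have h1 := succ_mul_besselCoeff_succ hν k
    have h2 := succ_mul_besselCoeff_succ (by linarith : 1 ≤ ν + 2) k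
    have h0 : ((k : ℝ) + 1) ≠ 0 := by positivity
    have h3 : besselCoeff (ν + 2) (k + 1) =
      -besselCoeff (ν + 2) k / ((k + 1) * (4 * k + 2 * (ν + 2))) := rfl
    have h5 : (4 * (k : ℝ) + 2 * (ν + 2)) ≠ 0 := by positivity
    have h6 : ν + 2 ≠ 0 := by positivity
    have h7 : besselCoeff (ν + 4) k = -(2 * (ν + 2)) * ((k + 1) * besselCoeff (ν + 2) (k + 1)) := by
      rw [h2, show ν + 2 + 2 = ν + 4 by ring]
      field_simp
    have h8 : besselCoeff ν (k + 1) = -(1 / (2 * ν)) * besselCoeff (ν + 2) k / (k + 1) := by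
      rw [← h1]; field_simp
    rw [h7, h8, h3]
    field_simp
    ring
  rw [tsum_congr this, tsum_zero] at hsum2
  linarith

/-- The radial eigenfunction profile `r ↦ besselF n (r ^ 2)` in dimension `n = N + 1`. -/
noncomputable def profile (N : ℕ) (r : ℝ) : ℝ := besselF (N + 1) (r ^ 2)

/-- The derivative of `profile`. -/
noncomputable def profile' (N : ℕ) (r : ℝ) : ℝ := -(r / (N + 1)) * besselF (N + 3) (r ^ 2)

/-- The second derivative of `profile`. -/
noncomputable def profile'' (N : ℕ) (r : ℝ) : ℝ :=
  -(1 / (N + 1)) * besselF (N + 3) (r ^ 2) +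
    r ^ 2 / ((N + 1) * (N + 3)) * besselF (N + 5) (r ^ 2)

theorem hasDerivAt_besselF_sq {ν : ℝ} (hν : 1 ≤ ν) (r : ℝ) :
    HasDerivAt (fun r => besselF ν (r ^ 2)) (-(r / ν) * besselF (ν + 2) (r ^ 2)) r := by
  refine ((hasDerivAt_besselF hν (r ^ 2)).comp r (hasDerivAt_pow 2 r)).congr_deriv ?_
  have : ν ≠ 0 := by positivity
  field_simp
  push_cast
  ring

theorem hasDerivAt_profile (N : ℕ) (r : ℝ) : HasDerivAt (profile N) (profile' N r) r := by
  refine (hasDerivAt_besselF_sq (ν := N + 1) (by simp) r).congr_deriv ?_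
  rw [profile']
  ring_nf

theorem hasDerivAt_profile' (N : ℕ) (r : ℝ) : HasDerivAt (profile' N) (profile'' N r) r := by
  refine ((((hasDerivAt_id r).div_const ((N : ℝ) + 1)).neg).mul (hasDerivAt_besselF_sq
    (ν := N + 3) (by linarith [(N.cast_nonneg : (0 : ℝ) ≤ N)]) r)).congr_deriv ?_
  rw [profile'', show (N : ℝ) + 3 + 2 = N + 5 by ring]
  simp
  field_simp

theorem profile_ode (N : ℕ) (r : ℝ) :
    r * profile'' N r + N * profile' N r + r * profile N r = 0 := by
  have h := besselF_ode (ν := N + 1) (by simp) (r ^ 2)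
  rw [show (N : ℝ) + 1 + 2 = N + 3 by ring, show (N : ℝ) + 1 + 4 = N + 5 by ring] at h
  have : (N : ℝ) + 1 ≠ 0 := by positivity
  calc r * profile'' N r + N * profile' N r + r * profile N r
      = r * (r ^ 2 * besselF (N + 5) (r ^ 2) / ((N + 1) * (N + 3)) - besselF (N + 3) (r ^ 2) +
        besselF (N + 1) (r ^ 2)) := by
        rw [profile, profile', profile'']
        field_simp
        ring
    _ = 0 := by rw [h, mul_zero]

theorem profile_zero (N : ℕ) : profile N 0 = 1 := by simp [profile, besselF_zero]

theorem profile'_zero (N : ℕ) : profile' N 0 = 0 := by simp [profile']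

theorem integral_ball_norm (N : ℕ) {R : ℝ} (hR : 0 ≤ R) (φ : ℝ → ℝ) :
    ∫ x in Metric.ball (0 : EuclideanSpace ℝ (Fin (N + 1))) R, φ ‖x‖ =
      (N + 1) * unitBallVolume N * ∫ r in (0 : ℝ)..R, r ^ N * φ r := by
  have h := integral_fun_norm_addHaar (volume : Measure (EuclideanSpace ℝ (Fin (N + 1))))
    ((Set.Iio R).indicator φ)
  have h1 : (fun x : EuclideanSpace ℝ (Fin (N + 1)) => (Set.Iio R).indicator φ ‖x‖) =
      (Metric.ball (0 : EuclideanSpace ℝ (Fin (N + 1))) R).indicator fun x => φ ‖x‖ := by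
    ext x
    simp [Set.indicator]
  have h2 : (fun r : ℝ => r ^ N • (Set.Iio R).indicator φ r) =
      (Set.Iio R).indicator fun r => r ^ N * φ r := by
    ext r
    simp [Set.indicator]
  rw [h1, integral_indicator measurableSet_ball] at h
  rw [h, finrank_euclideanSpace_fin, Nat.add_sub_cancel, h2,
    setIntegral_indicator measurableSet_Iio, Set.Ioi_inter_Iio, ← integral_Ioc_eq_integral_Ioo,
    ← intervalIntegral.integral_of_le hR]
  simp [unitBallVolume, Measure.real, mul_assoc]

theorem hasDerivAt_pow_mul {f : ℝ → ℝ} {f' r : ℝ} (hr : 0 < r) (N : ℕ) (hf : HasDerivAt f f' r) :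
    HasDerivAt (fun r => r ^ N * f r) (r ^ N * (N / r * f r + f')) r := by
  refine ((hasDerivAt_pow N r).mul hf).congr_deriv ?_
  rcases N with _ | N
  · simp
  · push_cast
    field_simp
    ring

theorem profile''_eq (N : ℕ) {r : ℝ} (hr : 0 < r) :
    profile'' N r = -(N / r * profile' N r) - profile N r := by
  have := profile_ode N r
  field_simp
  linarith

theorem continuous_profile (N : ℕ) : Continuous (profile N) :=
  continuous_iff_continuousAt.2 fun r => (hasDerivAt_profile N r).continuousAt

theorem continuous_profile' (N : ℕ) : Continuous (profile' N) :=
  continuous_iff_continuousAt.2 fun r => (hasDerivAt_profile' N r).continuousAt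

section profileRatio

variable {N : ℕ} {P : ℝ}

theorem profile'_nonpos (hv : ∀ r, 0 ≤ r → r ≤ P → 0 ≤ profile N r) {r : ℝ} (hr : 0 ≤ r)
    (hrP : r ≤ P) : profile' N r ≤ 0 := by
  rcases hr.eq_or_lt with rfl | hr
  · exact (profile'_zero N).le
  have h := antitoneOn_of_deriv_nonpos (convex_Icc 0 P)
    (f := fun r => r ^ N * profile' N r) ((continuous_pow N).mul (continuous_profile' N)).continuousOn
    (fun s hs => ?_) (fun s hs => ?_) (Set.left_mem_Icc.2 (hr.le.trans hrP)) ⟨hr.le, hrP⟩ hr.le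
  · dsimp only at h
    rw [profile'_zero, mul_zero] at h
    exact nonpos_of_mul_nonpos_right h (by positivity)
  all_goals
    rw [interior_Icc] at hs
    have hd := hasDerivAt_pow_mul hs.1 N (hasDerivAt_profile' N s)
  · exact hd.differentiableAt.differentiableWithinAt
  · rw [hd.deriv, profile''_eq N hs.1]
    have := hv s hs.1.le hs.2.le
    have h0 : 0 ≤ s ^ N := pow_nonneg hs.1.le N
    nlinarith

/-- The logarithmic derivative of `profile`, up to sign. -/
noncomputable def profileRatio (N : ℕ) (r : ℝ) : ℝ := -(profile' N r / profile N r)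

theorem profileRatio_zero (N : ℕ) : profileRatio N 0 = 0 := by
  simp [profileRatio, profile'_zero]

theorem hasDerivAt_profileRatio {r : ℝ} (h : profile N r ≠ 0) :
    HasDerivAt (profileRatio N)
      ((profile' N r ^ 2 - profile N r * profile'' N r) / profile N r ^ 2) r := by
  refine (((hasDerivAt_profile' N r).div (hasDerivAt_profile N r) h).neg).congr_deriv ?_
  ring

theorem profile_sq_sub_nonneg (hv : ∀ r, 0 ≤ r → r ≤ P → 0 ≤ profile N r) {r : ℝ} (hr : 0 < r)
    (hrP : r ≤ P) : 0 ≤ profile' N r ^ 2 - profile N r * profile'' N r := by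
  rcases N with _ | M
  · rw [profile''_eq 0 hr]
    have := sq_nonneg (profile' 0 r)
    have := sq_nonneg (profile 0 r)
    simp
    nlinarith
  set w : ℝ → ℝ := fun s => s * (profile' (M + 1) s ^ 2 + profile (M + 1) s ^ 2) +
      (M + 1) * (profile (M + 1) s * profile' (M + 1) s) with hw
  have hwd : ∀ s, HasDerivAt w _ s := fun s =>
    ((hasDerivAt_id s).mul (((hasDerivAt_profile' (M + 1) s).pow 2).add
      ((hasDerivAt_profile (M + 1) s).pow 2))).add
      (((hasDerivAt_profile (M + 1) s).mul (hasDerivAt_profile' (M + 1) s)).const_mul ((M : ℝ) + 1))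
  have h := monotoneOn_of_deriv_nonneg (convex_Icc 0 P) (f := fun s => s ^ M * w s)
    ((continuous_pow M).mul (continuous_iff_continuousAt.2
      fun s => (hwd s).continuousAt)).continuousOn
    (fun s hs => ?_) (fun s hs => ?_) (Set.left_mem_Icc.2 (hr.le.trans hrP)) ⟨hr.le, hrP⟩ hr.le
  · have h0 : w 0 = 0 := by simp [hw, profile'_zero]
    dsimp only at h
    rw [h0, mul_zero] at h
    have h1 : 0 ≤ w r := nonneg_of_mul_nonneg_right h (by positivity)
    rw [profile''_eq _ hr]
    have h2 : profile' (M + 1) r ^ 2 - profile (M + 1) r *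
        (-((M + 1 : ℕ) / r * profile' (M + 1) r) - profile (M + 1) r) = w r / r := by
      rw [hw]
      push_cast
      field_simp
      ring
    rw [h2]
    positivity
  all_goals
    rw [interior_Icc] at hs
    have hd := hasDerivAt_pow_mul hs.1 M (hwd s)
  · exact hd.differentiableAt.differentiableWithinAt
  · have hs0 : 0 < s := hs.1
    have h1 := profile'_nonpos hv hs.1.le hs.2.le
    have h2 := hv s hs.1.le hs.2.le
    rw [hd.deriv]
    refine le_of_le_of_eq (b := s ^ M * ((M + 1) * (profile (M + 1) s * -profile' (M + 1) s) / s)) ?_ ?_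
    · have : 0 ≤ -profile' (M + 1) s := by linarith
      positivity
    · rw [hw, profile''_eq _ hs0]
      simp only [Pi.add_apply, Pi.pow_apply, id, Nat.add_one_sub_one, pow_one]
      push_cast
      field_simp
      ring

theorem monotoneOn_profileRatio (hv : ∀ r, 0 ≤ r → r ≤ P → 0 < profile N r) :
    MonotoneOn (profileRatio N) (Set.Icc 0 P) := by
  refine monotoneOn_of_deriv_nonneg (convex_Icc 0 P) (fun s hs => ?_) (fun s hs => ?_)
    fun s hs => ?_
  · exact (hasDerivAt_profileRatio (hv s hs.1 hs.2).ne').continuousAt.continuousWithinAt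
  all_goals
    rw [interior_Icc] at hs
    have hd := hasDerivAt_profileRatio (hv s hs.1.le hs.2.le).ne'
  · exact hd.differentiableAt.differentiableWithinAt
  · rw [hd.deriv]
    have := profile_sq_sub_nonneg (fun r h1 h2 => (hv r h1 h2).le) hs.1 hs.2.le
    positivity

theorem integral_profileRatio (hv : ∀ r, 0 ≤ r → r ≤ P → 0 < profile N r) {r : ℝ} (hr : 0 ≤ r)
    (hrP : r ≤ P) :
    ∫ s in (0 : ℝ)..r, s ^ N * (profileRatio N s ^ 2 + 1) = r ^ N * profileRatio N r := by
  have hc : ContinuousOn (profileRatio N) (Set.Icc 0 r) := fun s hs =>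
    (hasDerivAt_profileRatio (hv s hs.1 (hs.2.trans hrP)).ne').continuousAt.continuousWithinAt
  rw [intervalIntegral.integral_eq_sub_of_hasDerivAt_of_le (f := fun s => s ^ N * profileRatio N s)
    hr ((continuous_pow N).continuousOn.mul hc) (f' := fun s => s ^ N * (profileRatio N s ^ 2 + 1))
    (fun s hs => ?_) ?_]
  · simp [profileRatio_zero]
  · apply ContinuousOn.intervalIntegrable
    rw [Set.uIcc_of_le hr]
    fun_prop
  · have hs0 : 0 < s := hs.1
    have hv0 := (hv s hs.1.le (hs.2.le.trans hrP)).ne'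
    refine (hasDerivAt_pow_mul hs0 N (hasDerivAt_profileRatio hv0)).congr_deriv ?_
    rw [profile''_eq N hs0, profileRatio]
    field_simp
    ring

/-- A radial supersolution of the Riccati equation obtained from `profile` by scaling. -/
noncomputable def riccati (N : ℕ) (κ R r : ℝ) : ℝ := κ * profileRatio N (κ * max 0 (min r R))

theorem monotone_riccati {κ R : ℝ} (hκ : 0 ≤ κ) (hR : 0 ≤ R)
    (hv : ∀ r, 0 ≤ r → r ≤ κ * R → 0 < profile N r) : Monotone (riccati N κ R) := by
  intro r s hrs
  have hm : ∀ r : ℝ, κ * max 0 (min r R) ∈ Set.Icc 0 (κ * R) := fun r =>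
    ⟨by positivity, by gcongr; exact max_le hR (min_le_right _ _)⟩
  refine mul_le_mul_of_nonneg_left (monotoneOn_profileRatio hv (hm r) (hm s) ?_) hκ
  gcongr

theorem riccati_of_nonpos {κ R r : ℝ} (hr : r ≤ 0) : riccati N κ R r = 0 := by
  rw [riccati, max_eq_left ((min_le_left _ _).trans hr), mul_zero, profileRatio_zero, mul_zero]

theorem setLIntegral_ball_riccati {κ R : ℝ} (hκ : 0 < κ) (hR : 0 ≤ R)
    (hv : ∀ r, 0 ≤ r → r ≤ κ * R → 0 < profile N r) {r : ℝ} (hr : 0 ≤ r) (hrR : r ≤ R) :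
    ∫⁻ y in Metric.ball (0 : EuclideanSpace ℝ (Fin (N + 1))) r,
      ENNReal.ofReal (riccati N κ R ‖y‖ ^ 2 + κ ^ 2) =
        ENNReal.ofReal ((N + 1) * unitBallVolume N * r ^ N * riccati N κ R r) := by
  have hmono := monotone_riccati hκ.le hR hv
  have heq : ∀ s, 0 ≤ s → s ≤ R → riccati N κ R s = κ * profileRatio N (κ * s) := fun s h1 h2 => by
    rw [riccati, min_eq_left h2, max_eq_right h1]
  have hnn : ∀ s, 0 ≤ riccati N κ R s := fun s => by
    rcases le_total s 0 with h | h
    · exact (riccati_of_nonpos h).ge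
    · exact (riccati_of_nonpos le_rfl).ge.trans (hmono h)
  have hm : Measurable (riccati N κ R) := hmono.measurable
  rw [← ofReal_integral_eq_lintegral_ofReal]
  · congr 1
    rw [integral_ball_norm N hr fun s => riccati N κ R s ^ 2 + κ ^ 2, mul_assoc _ (r ^ N)]
    congr 1
    have h1 : ∫ s in (0 : ℝ)..r, s ^ N * (riccati N κ R s ^ 2 + κ ^ 2) =
        ∫ s in (0 : ℝ)..r, κ ^ 2 / κ ^ N * ((κ * s) ^ N * (profileRatio N (κ * s) ^ 2 + 1)) := by
      refine intervalIntegral.integral_congr fun s hs => ?_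
      rw [Set.uIcc_of_le hr] at hs
      simp only [heq s hs.1 (hs.2.trans hrR), mul_pow]
      field_simp
    rw [h1, intervalIntegral.integral_const_mul, intervalIntegral.integral_comp_mul_left
      (fun s => s ^ N * (profileRatio N s ^ 2 + 1)) hκ.ne', mul_zero,
      integral_profileRatio hv (by positivity) (by gcongr), heq r hr hrR, smul_eq_mul, mul_pow]
    field_simp
  · refine Measure.integrableOn_of_bounded (M := riccati N κ R R ^ 2 + κ ^ 2)
      measure_ball_lt_top.ne ?_ (ae_restrict_of_forall_mem measurableSet_ball fun y hy => ?_)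
    · exact (((hm.comp measurable_norm).pow_const 2).add_const _).aestronglyMeasurable
    · rw [Real.norm_eq_abs, abs_of_nonneg (by positivity)]
      have := hnn ‖y‖
      have := hmono ((mem_ball_zero_iff.1 hy).le.trans hrR)
      gcongr
  · exact Filter.Eventually.of_forall fun y => by positivity

end profileRatio

theorem norm_gradient_eq {n : ℕ} (u : EuclideanSpace ℝ (Fin n) → ℝ) (x : EuclideanSpace ℝ (Fin n)) :
    ‖gradient u x‖ = ‖fderiv ℝ u x‖ := by
  rw [gradient, LinearIsometryEquiv.norm_map]

theorem setIntegral_sq_eq {n : ℕ} {Ω : Set (EuclideanSpace ℝ (Fin n))}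
    {u : EuclideanSpace ℝ (Fin n) → ℝ} (hs : tsupport u ⊆ Ω) :
    ∫ x in Ω, u x ^ 2 = ∫ x, u x ^ 2 := by
  refine setIntegral_eq_integral_of_forall_compl_eq_zero fun x hx => ?_
  rw [image_eq_zero_of_notMem_tsupport fun h => hx (hs h), zero_pow two_ne_zero]

theorem setIntegral_norm_gradient_sq_eq {n : ℕ} {Ω : Set (EuclideanSpace ℝ (Fin n))}
    {u : EuclideanSpace ℝ (Fin n) → ℝ} (hs : tsupport u ⊆ Ω) :
    ∫ x in Ω, ‖gradient u x‖ ^ 2 = ∫ x, ‖fderiv ℝ u x‖ ^ 2 := by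
  simp_rw [norm_gradient_eq]
  refine setIntegral_eq_integral_of_forall_compl_eq_zero fun x hx => ?_
  rw [fderiv_of_notMem_tsupport ℝ fun h => hx (hs h), norm_zero, zero_pow two_ne_zero]

theorem integrable_sq_of_hasCompactSupport {n : ℕ} {u : EuclideanSpace ℝ (Fin n) → ℝ}
    (hu : Continuous u) (hc : HasCompactSupport u) : Integrable fun x => u x ^ 2 := by
  refine Continuous.integrable_of_hasCompactSupport (hu.pow 2) ?_
  exact hc.comp_left (g := fun y : ℝ => y ^ 2) (zero_pow two_ne_zero)

theorem integrable_norm_fderiv_sq {n : ℕ} {u : EuclideanSpace ℝ (Fin n) → ℝ}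
    (hu : ContDiff ℝ (⊤ : ℕ∞) u) (hc : HasCompactSupport u) :
    Integrable fun x => ‖fderiv ℝ u x‖ ^ 2 :=
  integrable_sq_of_hasCompactSupport (hu.continuous_fderiv (by simp)).norm (hc.fderiv ℝ).norm

theorem sq_mul_setIntegral_sq_le {N : ℕ} {Ω : Set (EuclideanSpace ℝ (Fin (N + 1)))} {R κ : ℝ}
    (hR : 0 ≤ R)
    (hvol : volume Ω ≤ volume (Metric.ball (0 : EuclideanSpace ℝ (Fin (N + 1))) R))
    {u : EuclideanSpace ℝ (Fin (N + 1)) → ℝ} (hu : ContDiff ℝ (⊤ : ℕ∞) u)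
    (hc : HasCompactSupport u) (hs : tsupport u ⊆ Ω) (hκ : 0 < κ)
    (hv : ∀ r, 0 ≤ r → r ≤ κ * R → 0 < profile N r) :
    κ ^ 2 * (∫ x in Ω, u x ^ 2) ≤ ∫ x in Ω, ‖gradient u x‖ ^ 2 := by
  rw [setIntegral_sq_eq hs, setIntegral_norm_gradient_sq_eq hs]
  have hdiff : Differentiable ℝ u := hu.differentiable (by simp)
  have hdc : Continuous (fderiv ℝ u) := hu.continuous_fderiv (by simp)
  obtain ⟨B, hB⟩ := hu.continuous.bounded_above_of_compact_support hc
  obtain ⟨G, hG⟩ := hdc.bounded_above_of_compact_support (hc.fderiv ℝ)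
  obtain ⟨C, hC⟩ := ContDiff.lipschitzWith_of_hasCompactSupport (𝕂 := ℝ) (n := 1) (hc.fderiv ℝ)
    (hu.fderiv_right (m := 1) (by norm_cast)) one_ne_zero
  obtain ⟨S, hS⟩ := hc.isCompact.isBounded.subset_ball 0
  have hfg : ∀ x y, |u y| ≤ |u x| + ‖fderiv ℝ u x‖ * ‖y - x‖ + C * ‖y - x‖ ^ 2 := by
    intro x y
    have h := (convex_closedBall x ‖y - x‖).norm_image_sub_le_of_norm_fderiv_le' (𝕜 := ℝ) (f := u)
      (φ := fderiv ℝ u x) (C := C * ‖y - x‖) (x := x) (y := y) (fun z _ => hdiff z)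
      (fun z hz => by
        refine (hC.norm_sub_le z x).trans ?_
        gcongr
        simpa [dist_eq_norm] using hz) (by simp) (by simp [dist_eq_norm])
    have h1 : u y = u x + fderiv ℝ u x (y - x) + (u y - u x - fderiv ℝ u x (y - x)) := by ring
    calc |u y| = |u x + fderiv ℝ u x (y - x) + (u y - u x - fderiv ℝ u x (y - x))| := by rw [← h1]
      _ ≤ |u x| + |fderiv ℝ u x (y - x)| + |u y - u x - fderiv ℝ u x (y - x)| := abs_add_three _ _ _
      _ ≤ |u x| + ‖fderiv ℝ u x‖ * ‖y - x‖ + C * ‖y - x‖ * ‖y - x‖ := by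
        gcongr
        · exact (fderiv ℝ u x).le_opNorm _
        · exact h
      _ = _ := by ring
  have hsupp : ∀ x, S ≤ ‖x‖ → |u x| = 0 := fun x hx => by
    rw [abs_eq_zero]
    refine image_eq_zero_of_notMem_tsupport fun h => ?_
    have := mem_ball_zero_iff.1 (hS h)
    linarith
  have hvol' : volume {x | 0 < |u x|} ≤
      volume (Metric.ball (0 : EuclideanSpace ℝ (Fin (N + 1))) R) := by
    refine (measure_mono fun x hx => hs (subset_tsupport u ?_)).trans hvol
    exact abs_pos.1 hx
  have key := mul_lintegral_sq_le (f := fun x => |u x|) (g := fun x => ‖fderiv ℝ u x‖)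
    hu.continuous.abs (fun x => abs_nonneg _) hB hdc.norm (fun x => norm_nonneg _) hG
    C.coe_nonneg hfg hsupp hR hvol' (monotone_riccati hκ.le hR hv)
    (fun r hr => riccati_of_nonpos hr) (sq_nonneg κ)
    (fun r h1 h2 => (setLIntegral_ball_riccati hκ hR hv h1 h2).le)
  simp_rw [sq_abs] at key
  rw [← ofReal_integral_eq_lintegral_ofReal (integrable_sq_of_hasCompactSupport hu.continuous hc)
      (Filter.Eventually.of_forall fun x => sq_nonneg _),
    ← ofReal_integral_eq_lintegral_ofReal (integrable_norm_fderiv_sq hu hc)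
      (Filter.Eventually.of_forall fun x => by positivity),
    ← ENNReal.ofReal_mul (sq_nonneg _),
    ENNReal.ofReal_le_ofReal_iff (integral_nonneg fun x => by positivity)] at key
  exact key

theorem setIntegral_sq_pos {n : ℕ} {Ω : Set (EuclideanSpace ℝ (Fin n))}
    {u : EuclideanSpace ℝ (Fin n) → ℝ} (hu : Continuous u) (hc : HasCompactSupport u)
    (hs : tsupport u ⊆ Ω) (h0 : u ≠ 0) : 0 < ∫ x in Ω, u x ^ 2 := by
  rw [setIntegral_sq_eq hs]
  obtain ⟨x, hx⟩ := Function.ne_iff.1 h0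
  exact Continuous.integral_pos_of_hasCompactSupport_nonneg_nonzero (hu.pow 2)
    (hc.comp_left (g := fun y : ℝ => y ^ 2) (zero_pow two_ne_zero)) (fun x => sq_nonneg _) (x := x)
    (pow_ne_zero 2 hx)

theorem exists_test_function {n : ℕ} {Ω : Set (EuclideanSpace ℝ (Fin n))} (hne : Ω.Nonempty)
    (ho : IsOpen Ω) : ∃ u : EuclideanSpace ℝ (Fin n) → ℝ,
      ContDiff ℝ (⊤ : ℕ∞) u ∧ HasCompactSupport u ∧ tsupport u ⊆ Ω ∧ u ≠ 0 := by
  obtain ⟨x, hx⟩ := hne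
  obtain ⟨u, h1, h2, h3, -, h5⟩ := exists_contDiff_tsupport_subset (n := (⊤ : ℕ∞))
    (ho.mem_nhds hx)
  refine ⟨u, h3, h2, h1, fun h => ?_⟩
  simp [h] at h5

theorem exists_profile_first_zero (N : ℕ) :
    ∃ j, 0 < j ∧ profile N j = 0 ∧ ∀ r, 0 ≤ r → r < j → 0 < profile N r := by
  set Z := {r : ℝ | 0 ≤ r ∧ profile N r ≤ 0} with hZ
  have hne : Z.Nonempty := by
    by_contra hZe
    have hpos : ∀ r, 0 ≤ r → 0 < profile N r := fun r hr => by
      by_contra! h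
      exact hZe ⟨r, hr, h⟩
    obtain ⟨u, hu, hc, hs, h0⟩ := exists_test_function
      (⟨0, Metric.mem_ball_self one_pos⟩ :
        (Metric.ball (0 : EuclideanSpace ℝ (Fin (N + 1))) 1).Nonempty) Metric.isOpen_ball
    have hI := setIntegral_sq_pos hu.continuous hc hs h0
    obtain ⟨m, hm⟩ := exists_nat_gt ((∫ x in Metric.ball 0 1, ‖gradient u x‖ ^ 2) /
      ∫ x in Metric.ball 0 1, u x ^ 2)
    have h := sq_mul_setIntegral_sq_le zero_le_one le_rfl hu hc hs (Nat.cast_add_one_pos (α := ℝ) m)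
      fun r hr _ => hpos r hr
    rw [div_lt_iff₀ hI] at hm
    have : (m : ℝ) ≤ (m + 1) ^ 2 := by nlinarith [(m.cast_nonneg : (0 : ℝ) ≤ m)]
    nlinarith
  have hcl : IsClosed Z := isClosed_Ici.inter (isClosed_Iic.preimage (continuous_profile N))
  have hbd : BddBelow Z := ⟨0, fun r hr => hr.1⟩
  have hj := hcl.csInf_mem hne hbd
  set j := sInf Z
  have hz : profile N j = 0 := by
    obtain ⟨s, hs, hs0⟩ := intermediate_value_Icc' hj.1 (continuous_profile N).continuousOn
      (Set.mem_Icc.2 ⟨hj.2, by rw [profile_zero]; exact zero_le_one⟩)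
    have : j ≤ s := csInf_le hbd ⟨hs.1, hs0.le⟩
    rwa [← le_antisymm hs.2 this]
  refine ⟨j, hj.1.lt_of_ne fun h => ?_, hz, fun r h0 hr => ?_⟩
  · rw [← h, profile_zero] at hz
    exact one_ne_zero hz
  · by_contra! h
    exact (csInf_le hbd ⟨h0, h⟩).not_gt hr

theorem sq_first_zero_mul_setIntegral_sq_le {N : ℕ} {Ω : Set (EuclideanSpace ℝ (Fin (N + 1)))}
    {R j : ℝ} (hR : 0 < R) (hj : 0 < j)
    (hvol : volume Ω ≤ volume (Metric.ball (0 : EuclideanSpace ℝ (Fin (N + 1))) R))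
    {u : EuclideanSpace ℝ (Fin (N + 1)) → ℝ} (hu : ContDiff ℝ (⊤ : ℕ∞) u)
    (hc : HasCompactSupport u) (hs : tsupport u ⊆ Ω)
    (hv : ∀ r, 0 ≤ r → r < j → 0 < profile N r) :
    (j / R) ^ 2 * (∫ x in Ω, u x ^ 2) ≤ ∫ x in Ω, ‖gradient u x‖ ^ 2 := by
  have hlim : Filter.Tendsto (fun κ : ℝ => κ ^ 2 * (∫ x in Ω, u x ^ 2)) (nhdsWithin (j / R)
      (Set.Iio (j / R))) (nhds ((j / R) ^ 2 * (∫ x in Ω, u x ^ 2))) :=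
    (Continuous.tendsto (by fun_prop) _).mono_left nhdsWithin_le_nhds
  refine le_of_tendsto hlim ?_
  filter_upwards [Ioo_mem_nhdsLT (div_pos hj hR)] with κ hκ
  refine sq_mul_setIntegral_sq_le hR.le hvol hu hc hs hκ.1 fun r h0 hr => hv r h0 (hr.trans_lt ?_)
  exact (lt_div_iff₀ hR).1 hκ.2

/-- A smooth function vanishing on `t ≤ 1` and equal to the identity for `t ≥ 2`. -/
noncomputable def smoothRamp (t : ℝ) : ℝ := t * smoothTransition (t - 1)

theorem contDiff_smoothRamp : ContDiff ℝ (⊤ : ℕ∞) smoothRamp :=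
  contDiff_id.mul (smoothTransition.contDiff.comp (contDiff_id.sub contDiff_const))

theorem smoothRamp_of_le_one {t : ℝ} (ht : t ≤ 1) : smoothRamp t = 0 := by
  rw [smoothRamp, smoothTransition.zero_of_nonpos (by linarith), mul_zero]

theorem smoothRamp_of_two_le {t : ℝ} (ht : 2 ≤ t) : smoothRamp t = t := by
  rw [smoothRamp, smoothTransition.one_of_one_le (by linarith), mul_one]

theorem abs_smoothRamp_le (t : ℝ) : |smoothRamp t| ≤ |t| := by
  rw [smoothRamp, abs_mul, abs_of_nonneg (smoothTransition.nonneg _)]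
  exact mul_le_of_le_one_right (abs_nonneg t) (smoothTransition.le_one _)

theorem deriv_smoothRamp_of_two_lt {t : ℝ} (ht : 2 < t) : deriv smoothRamp t = 1 := by
  rw [Filter.EventuallyEq.deriv_eq (f := id), deriv_id]
  filter_upwards [lt_mem_nhds ht] with s hs using smoothRamp_of_two_le hs.le

theorem deriv_smoothRamp_of_lt_one {t : ℝ} (ht : t < 1) : deriv smoothRamp t = 0 := by
  rw [Filter.EventuallyEq.deriv_eq (f := fun _ => 0), deriv_const]
  filter_upwards [gt_mem_nhds ht] with s hs using smoothRamp_of_le_one hs.le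

theorem exists_abs_deriv_smoothRamp_le : ∃ K, ∀ t, |deriv smoothRamp t| ≤ K := by
  obtain ⟨K, hK⟩ := (isCompact_Icc (a := (1 : ℝ)) (b := 2)).exists_bound_of_continuousOn
    (contDiff_smoothRamp.continuous_deriv (by simp)).continuousOn
  refine ⟨max K 1, fun t => ?_⟩
  rcases lt_or_ge t 1 with h1 | h1
  · rw [deriv_smoothRamp_of_lt_one h1, abs_zero]
    exact zero_le_one.trans (le_max_right _ _)
  rcases lt_or_ge 2 t with h2 | h2
  · rw [deriv_smoothRamp_of_two_lt h2, abs_one]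
    exact le_max_right _ _
  · exact (hK t ⟨h1, h2⟩).trans (le_max_left _ _)

/-- The radial function `x ↦ profile N (j * ‖x‖)`. -/
noncomputable def radialProfile (N : ℕ) (j : ℝ) (x : EuclideanSpace ℝ (Fin (N + 1))) : ℝ :=
  profile N (j * ‖x‖)

theorem contDiff_radialProfile (N : ℕ) (j : ℝ) : ContDiff ℝ (⊤ : ℕ∞) (radialProfile N j) := by
  have : radialProfile N j = fun x => besselF (N + 1) (j ^ 2 * ‖x‖ ^ 2) := by
    ext x
    rw [radialProfile, profile, mul_pow]
  rw [this]
  exact (contDiff_besselF (by simp)).comp (contDiff_const.mul (contDiff_norm_sq ℝ))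

theorem norm_fderiv_radialProfile (N : ℕ) {j : ℝ} (hj : 0 ≤ j)
    (x : EuclideanSpace ℝ (Fin (N + 1))) :
    ‖fderiv ℝ (radialProfile N j) x‖ = j * |profile' N (j * ‖x‖)| := by
  have hfun : radialProfile N j = fun x => besselF (N + 1) (j ^ 2 * ‖x‖ ^ 2) := by
    ext x
    rw [radialProfile, profile, mul_pow]
  have hN : (1 : ℝ) ≤ N + 1 := by simp
  have h := (hasDerivAt_besselF hN (j ^ 2 * ‖x‖ ^ 2)).comp_hasFDerivAt x
    ((hasStrictFDerivAt_norm_sq x).hasFDerivAt.const_mul (j ^ 2))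
  rw [hfun, HasFDerivAt.fderiv (f := fun x : EuclideanSpace ℝ (Fin (N + 1)) =>
    besselF (N + 1) (j ^ 2 * ‖x‖ ^ 2)) h]
  simp only [norm_smul, innerSL_apply_norm, ← Nat.cast_smul_eq_nsmul ℝ]
  rw [profile', abs_mul, abs_neg, abs_div, abs_mul, abs_of_nonneg hj, abs_of_nonneg (norm_nonneg x),
    mul_pow, show (N : ℝ) + 1 + 2 = N + 3 by ring]
  simp only [Real.norm_eq_abs, abs_mul, abs_neg, abs_div, abs_one, abs_pow, abs_of_nonneg hj,
    abs_two, Nat.cast_ofNat]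
  have : |(N : ℝ) + 1| ≠ 0 := abs_ne_zero.2 (by positivity)
  field_simp

theorem integral_profile'_sq (N : ℕ) {j : ℝ} (hj : 0 ≤ j) (hz : profile N j = 0) :
    ∫ s in (0 : ℝ)..j, s ^ N * profile' N s ^ 2 = ∫ s in (0 : ℝ)..j, s ^ N * profile N s ^ 2 := by
  have hc := continuous_profile N
  have hc' := continuous_profile' N
  have h := intervalIntegral.integral_eq_sub_of_hasDerivAt_of_le
    (f := fun s => s ^ N * (profile N s * profile' N s))
    (f' := fun s => s ^ N * profile' N s ^ 2 - s ^ N * profile N s ^ 2) hj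
    (by fun_prop) (fun s hs => ?_) (Continuous.intervalIntegrable (by fun_prop) _ _)
  · rw [intervalIntegral.integral_sub (Continuous.intervalIntegrable (by fun_prop) _ _)
      (Continuous.intervalIntegrable (by fun_prop) _ _)] at h
    simp only [hz, profile'_zero, zero_mul, mul_zero, sub_zero] at h
    exact sub_eq_zero.1 h
  · have hs0 : 0 < s := hs.1
    refine (hasDerivAt_pow_mul hs0 N
      ((hasDerivAt_profile N s).mul (hasDerivAt_profile' N s))).congr_deriv ?_
    rw [profile''_eq N hs0]
    simp only [Pi.mul_apply]
    field_simp
    ring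

theorem integral_ball_comp_mul_norm (N : ℕ) {j : ℝ} (hj : 0 < j) (φ : ℝ → ℝ) :
    ∫ x in Metric.ball (0 : EuclideanSpace ℝ (Fin (N + 1))) 1, φ (j * ‖x‖) =
      (N + 1) * unitBallVolume N / j ^ (N + 1) * ∫ s in (0 : ℝ)..j, s ^ N * φ s := by
  rw [integral_ball_norm N zero_le_one fun r => φ (j * r)]
  have h1 : ∫ r in (0 : ℝ)..1, r ^ N * φ (j * r) =
      ∫ r in (0 : ℝ)..1, 1 / j ^ N * ((j * r) ^ N * φ (j * r)) := by
    refine intervalIntegral.integral_congr fun r _ => ?_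
    simp only [mul_pow]
    field_simp
  rw [h1, intervalIntegral.integral_const_mul, intervalIntegral.integral_comp_mul_left
    (fun s => s ^ N * φ s) hj.ne', mul_zero, mul_one, smul_eq_mul]
  field_simp
  ring

theorem setIntegral_norm_fderiv_radialProfile_sq (N : ℕ) {j : ℝ} (hj : 0 < j)
    (hz : profile N j = 0) :
    ∫ x in Metric.ball (0 : EuclideanSpace ℝ (Fin (N + 1))) 1, ‖fderiv ℝ (radialProfile N j) x‖ ^ 2 =
      j ^ 2 * ∫ x in Metric.ball (0 : EuclideanSpace ℝ (Fin (N + 1))) 1, radialProfile N j x ^ 2 := by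
  simp_rw [norm_fderiv_radialProfile N hj.le, mul_pow, sq_abs, radialProfile]
  rw [integral_const_mul, integral_ball_comp_mul_norm N hj fun s => profile' N s ^ 2,
    integral_ball_comp_mul_norm N hj fun s => profile N s ^ 2, integral_profile'_sq N hj.le hz]

theorem integrableOn_ball_of_continuous {N : ℕ} {f : EuclideanSpace ℝ (Fin (N + 1)) → ℝ}
    (hf : Continuous f) : IntegrableOn f (Metric.ball 0 1) :=
  (hf.continuousOn.integrableOn_compact (isCompact_closedBall 0 1)).mono_set
    Metric.ball_subset_closedBall

/-- Smooth compactly supported approximations of `radialProfile` in the unit ball. -/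
noncomputable def truncatedProfile (N : ℕ) (j : ℝ) (m : ℕ) :
    EuclideanSpace ℝ (Fin (N + 1)) → ℝ :=
  (Metric.ball 0 1).indicator fun x => smoothRamp ((m + 1) * radialProfile N j x) / (m + 1)

section truncatedProfile

variable {N : ℕ} {j : ℝ} {m : ℕ}

theorem tsupport_truncatedProfile_subset (hz : profile N j = 0) :
    tsupport (truncatedProfile N j m) ⊆ Metric.ball 0 1 := by
  have hcl : IsClosed (Metric.closedBall (0 : EuclideanSpace ℝ (Fin (N + 1))) 1 ∩
      {x | 1 ≤ (m + 1) * radialProfile N j x}) :=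
    Metric.isClosed_closedBall.inter (isClosed_le continuous_const
      (continuous_const.mul (contDiff_radialProfile N j).continuous))
  have hsub : tsupport (truncatedProfile N j m) ⊆ _ := closure_minimal (fun x hx => ?_) hcl
  · intro x hx
    obtain ⟨h1, h2⟩ := hsub hx
    rw [mem_closedBall_zero_iff] at h1
    rw [mem_ball_zero_iff]
    refine h1.lt_of_ne fun h => ?_
    have h3 : (1 : ℝ) ≤ (m + 1) * radialProfile N j x := h2
    rw [radialProfile, h, mul_one, hz, mul_zero] at h3
    linarith
  · have hxb : x ∈ Metric.ball (0 : EuclideanSpace ℝ (Fin (N + 1))) 1 := by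
      by_contra h
      exact hx (Set.indicator_of_notMem h _)
    refine ⟨Metric.ball_subset_closedBall hxb, ?_⟩
    by_contra h
    rw [Set.mem_ofPred_eq, not_le] at h
    refine hx ?_
    rw [truncatedProfile, Set.indicator_of_mem hxb, smoothRamp_of_le_one h.le, zero_div]

theorem hasCompactSupport_truncatedProfile (hz : profile N j = 0) :
    HasCompactSupport (truncatedProfile N j m) :=
  (isCompact_closedBall 0 1).of_isClosed_subset (isClosed_tsupport _)
    ((tsupport_truncatedProfile_subset hz).trans Metric.ball_subset_closedBall)

theorem truncatedProfile_eventuallyEq {x : EuclideanSpace ℝ (Fin (N + 1))}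
    (hx : x ∈ Metric.ball (0 : EuclideanSpace ℝ (Fin (N + 1))) 1) :
    truncatedProfile N j m =ᶠ[nhds x]
      fun x => smoothRamp ((m + 1) * radialProfile N j x) / (m + 1) := by
  filter_upwards [Metric.isOpen_ball.mem_nhds hx] with y hy
  rw [truncatedProfile, Set.indicator_of_mem hy]

theorem contDiff_truncatedProfile (hz : profile N j = 0) :
    ContDiff ℝ (⊤ : ℕ∞) (truncatedProfile N j m) := by
  refine contDiff_iff_contDiffAt.2 fun x => ?_
  by_cases hx : x ∈ Metric.ball (0 : EuclideanSpace ℝ (Fin (N + 1))) 1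
  · refine ContDiffAt.congr_of_eventuallyEq ?_ (truncatedProfile_eventuallyEq hx)
    exact ((contDiff_smoothRamp.comp
      (contDiff_const.mul (contDiff_radialProfile N j))).div_const _).contDiffAt
  · refine contDiffAt_const.congr_of_eventuallyEq (notMem_tsupport_iff_eventuallyEq.1 fun h => ?_)
    exact hx (tsupport_truncatedProfile_subset hz h)

theorem fderiv_truncatedProfile {x : EuclideanSpace ℝ (Fin (N + 1))}
    (hx : x ∈ Metric.ball (0 : EuclideanSpace ℝ (Fin (N + 1))) 1) :
    fderiv ℝ (truncatedProfile N j m) x =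
      deriv smoothRamp ((m + 1) * radialProfile N j x) • fderiv ℝ (radialProfile N j) x := by
  rw [(truncatedProfile_eventuallyEq hx).fderiv_eq]
  have h1 : HasFDerivAt (radialProfile N j) (fderiv ℝ (radialProfile N j) x) x :=
    ((contDiff_radialProfile N j).differentiable (by simp) x).hasFDerivAt
  have h2 : HasDerivAt smoothRamp (deriv smoothRamp ((m + 1) * radialProfile N j x))
      ((m + 1) * radialProfile N j x) :=
    (contDiff_smoothRamp.differentiable (by simp) _).hasDerivAt
  have h3 := (h2.comp_hasFDerivAt x (h1.const_mul ((m : ℝ) + 1))).mul_const ((m : ℝ) + 1)⁻¹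
  have h4 := h3.fderiv
  simp_rw [div_eq_mul_inv]
  refine h4.trans ?_
  have hm : (m : ℝ) + 1 ≠ 0 := by positivity
  rw [smul_smul, smul_smul]
  congr 1
  field_simp

theorem eventually_two_lt_mul {c : ℝ} (hc : 0 < c) :
    ∀ᶠ m : ℕ in Filter.atTop, 2 < ((m : ℝ) + 1) * c := by
  filter_upwards [Filter.eventually_gt_atTop ⌈2 / c⌉₊] with m hm
  have := (Nat.le_ceil (2 / c)).trans_lt (Nat.cast_lt.2 hm)
  rw [div_lt_iff₀ hc] at this
  nlinarith

theorem radialProfile_pos (hj : 0 < j) (hv : ∀ r, 0 ≤ r → r < j → 0 < profile N r)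
    {x : EuclideanSpace ℝ (Fin (N + 1))}
    (hx : x ∈ Metric.ball (0 : EuclideanSpace ℝ (Fin (N + 1))) 1) : 0 < radialProfile N j x :=
  hv _ (by positivity) (mul_lt_of_lt_one_right hj (mem_ball_zero_iff.1 hx))

theorem tendsto_setIntegral_truncatedProfile_sq (hj : 0 < j) (hz : profile N j = 0)
    (hv : ∀ r, 0 ≤ r → r < j → 0 < profile N r) :
    Filter.Tendsto (fun m => ∫ x in Metric.ball 0 1, truncatedProfile N j m x ^ 2) Filter.atTop
      (nhds (∫ x in Metric.ball 0 1, radialProfile N j x ^ 2)) := by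
  have hc := (contDiff_radialProfile N j).continuous
  refine tendsto_integral_of_dominated_convergence (fun x => radialProfile N j x ^ 2)
    (fun m => ((contDiff_truncatedProfile hz).continuous.pow 2).aestronglyMeasurable)
    (integrableOn_ball_of_continuous (hc.pow 2))
    (fun m => ae_restrict_of_forall_mem measurableSet_ball fun x hx => ?_)
    (ae_restrict_of_forall_mem measurableSet_ball fun x hx => ?_)
  · rw [Real.norm_eq_abs, abs_of_nonneg (sq_nonneg _), truncatedProfile, Set.indicator_of_mem hx]
    refine sq_le_sq.2 ?_
    have hm : (0 : ℝ) < m + 1 := by positivity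
    rw [abs_div, abs_of_pos hm, div_le_iff₀ hm]
    refine (abs_smoothRamp_le _).trans (le_of_eq ?_)
    rw [abs_mul, abs_of_pos hm, mul_comm]
  · refine tendsto_const_nhds.congr' ?_
    filter_upwards [eventually_two_lt_mul (radialProfile_pos hj hv hx)] with m hm
    rw [truncatedProfile, Set.indicator_of_mem hx, smoothRamp_of_two_le hm.le]
    field_simp

theorem tendsto_setIntegral_norm_fderiv_truncatedProfile_sq (hj : 0 < j) (hz : profile N j = 0)
    (hv : ∀ r, 0 ≤ r → r < j → 0 < profile N r) :
    Filter.Tendsto (fun m => ∫ x in Metric.ball 0 1, ‖fderiv ℝ (truncatedProfile N j m) x‖ ^ 2)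
      Filter.atTop (nhds (∫ x in Metric.ball 0 1, ‖fderiv ℝ (radialProfile N j) x‖ ^ 2)) := by
  obtain ⟨K, hK⟩ := exists_abs_deriv_smoothRamp_le
  have hc := ((contDiff_radialProfile N j).continuous_fderiv (by simp)).norm
  refine tendsto_integral_of_dominated_convergence
    (fun x => (K * ‖fderiv ℝ (radialProfile N j) x‖) ^ 2)
    (fun m => ((((contDiff_truncatedProfile hz).continuous_fderiv
      (by simp)).norm).pow 2).aestronglyMeasurable)
    (integrableOn_ball_of_continuous ((continuous_const.mul hc).pow 2))
    (fun m => ae_restrict_of_forall_mem measurableSet_ball fun x hx => ?_)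
    (ae_restrict_of_forall_mem measurableSet_ball fun x hx => ?_)
  · rw [Real.norm_eq_abs, abs_of_nonneg (sq_nonneg _), fderiv_truncatedProfile hx, norm_smul]
    have := hK ((m + 1) * radialProfile N j x)
    rw [Real.norm_eq_abs]
    gcongr
  · refine tendsto_const_nhds.congr' ?_
    filter_upwards [eventually_two_lt_mul (radialProfile_pos hj hv hx)] with m hm
    rw [fderiv_truncatedProfile hx, deriv_smoothRamp_of_two_lt hm, one_smul]

end truncatedProfile

/-- The Rayleigh quotient of `u` on `Ω`. -/
noncomputable def rayleighQuotient {n : ℕ} (Ω : Set (EuclideanSpace ℝ (Fin n)))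
    (u : EuclideanSpace ℝ (Fin n) → ℝ) : ℝ :=
  (∫ x in Ω, ‖gradient u x‖ ^ 2) / (∫ x in Ω, (u x) ^ 2)

variable {n : ℕ} {Ω : Set (EuclideanSpace ℝ (Fin n))}

theorem rayleighQuotient_nonneg (u : EuclideanSpace ℝ (Fin n) → ℝ) : 0 ≤ rayleighQuotient Ω u :=
  div_nonneg (integral_nonneg fun x => by positivity) (integral_nonneg fun x => by positivity)

theorem rayleighQuotient_smul {u : EuclideanSpace ℝ (Fin n) → ℝ} (hu : ContDiff ℝ (⊤ : ℕ∞) u)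
    {c : ℝ} (hc : c ≠ 0) : rayleighQuotient Ω (c • u) = rayleighQuotient Ω u := by
  have h : ∀ x, ‖gradient (c • u) x‖ ^ 2 = c ^ 2 * ‖gradient u x‖ ^ 2 := fun x => by
    rw [norm_gradient_eq, norm_gradient_eq,
      fderiv_const_smul (hu.differentiable (by simp) x), norm_smul, mul_pow, Real.norm_eq_abs,
      sq_abs]
  simp_rw [rayleighQuotient, h, Pi.smul_apply, smul_eq_mul, mul_pow]
  rw [integral_const_mul, integral_const_mul, mul_div_mul_left _ _ (pow_ne_zero 2 hc)]

theorem setOf_rayleighQuotient_span {u : EuclideanSpace ℝ (Fin n) → ℝ}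
    (hu : ContDiff ℝ (⊤ : ℕ∞) u) (h0 : u ≠ 0) :
    { q : ℝ | ∃ w ∈ Submodule.span ℝ {u}, w ≠ (0 : EuclideanSpace ℝ (Fin n) → ℝ) ∧
      q = rayleighQuotient Ω w } = {rayleighQuotient Ω u} := by
  ext q
  constructor
  · rintro ⟨w, hw, hw0, rfl⟩
    obtain ⟨c, rfl⟩ := Submodule.mem_span_singleton.1 hw
    exact rayleighQuotient_smul hu (left_ne_zero_of_smul hw0)
  · rintro rfl
    exact ⟨u, Submodule.mem_span_singleton_self u, h0, rfl⟩

theorem dirichletEig_one_eq : dirichletEig Ω 1 = sInf {r : ℝ | ∃ u : EuclideanSpace ℝ (Fin n) → ℝ,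
    ContDiff ℝ (⊤ : ℕ∞) u ∧ HasCompactSupport u ∧ tsupport u ⊆ Ω ∧ u ≠ 0 ∧
      r = rayleighQuotient Ω u} := by
  unfold dirichletEig
  congr 1
  ext r
  constructor
  · rintro ⟨E, hE, hsub, rfl⟩
    obtain ⟨⟨u, huE⟩, hu0, hspan⟩ := finrank_eq_one_iff'.1 hE
    obtain ⟨h1, h2, h3⟩ := hsub u huE
    have h0 : u ≠ 0 := fun h => hu0 (Subtype.ext h)
    have hEu : E = Submodule.span ℝ {u} := by
      refine le_antisymm (fun w hw => ?_) ((Submodule.span_singleton_le_iff_mem _ _).2 huE)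
      obtain ⟨c, hc⟩ := hspan ⟨w, hw⟩
      exact Submodule.mem_span_singleton.2 ⟨c, congrArg Subtype.val hc⟩
    refine ⟨u, h1, h2, h3, h0, ?_⟩
    have := setOf_rayleighQuotient_span (Ω := Ω) h1 h0
    rw [← hEu] at this
    exact (congrArg sSup this).trans (csSup_singleton _)
  · rintro ⟨u, h1, h2, h3, h0, rfl⟩
    refine ⟨Submodule.span ℝ {u}, finrank_span_singleton h0, fun w hw => ?_, ?_⟩
    · obtain ⟨c, rfl⟩ := Submodule.mem_span_singleton.1 hw
      refine ⟨h1.const_smul c, h2.smul_left (f := fun _ => c), ?_⟩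
      exact (closure_mono (Function.support_const_smul_subset c u)).trans h3
    · exact ((congrArg sSup (setOf_rayleighQuotient_span (Ω := Ω) h1 h0)).trans
        (csSup_singleton _)).symm

theorem dirichletEig_one_le {u : EuclideanSpace ℝ (Fin n) → ℝ} (hu : ContDiff ℝ (⊤ : ℕ∞) u)
    (hc : HasCompactSupport u) (hs : tsupport u ⊆ Ω) (h0 : u ≠ 0) :
    dirichletEig Ω 1 ≤ rayleighQuotient Ω u := by
  rw [dirichletEig_one_eq]
  refine csInf_le ⟨0, ?_⟩ ⟨u, hu, hc, hs, h0, rfl⟩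
  rintro _ ⟨w, -, -, -, -, rfl⟩
  exact rayleighQuotient_nonneg w

theorem le_dirichletEig_one (hne : Ω.Nonempty) (ho : IsOpen Ω) {a : ℝ}
    (h : ∀ u : EuclideanSpace ℝ (Fin n) → ℝ, ContDiff ℝ (⊤ : ℕ∞) u → HasCompactSupport u →
      tsupport u ⊆ Ω → a * (∫ x in Ω, u x ^ 2) ≤ ∫ x in Ω, ‖gradient u x‖ ^ 2) :
    a ≤ dirichletEig Ω 1 := by
  rw [dirichletEig_one_eq]
  refine le_csInf ?_ ?_
  · obtain ⟨u, h1, h2, h3, h0⟩ := exists_test_function hne ho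
    exact ⟨_, u, h1, h2, h3, h0, rfl⟩
  · rintro _ ⟨u, h1, h2, h3, h0, rfl⟩
    exact (le_div_iff₀ (setIntegral_sq_pos h1.continuous h2 h3 h0)).2 (h u h1 h2 h3)

theorem dirichletEig_one_ball_le {N : ℕ} {j : ℝ} (hj : 0 < j) (hz : profile N j = 0)
    (hv : ∀ r, 0 ≤ r → r < j → 0 < profile N r) :
    dirichletEig (Metric.ball (0 : EuclideanSpace ℝ (Fin (N + 1))) 1) 1 ≤ j ^ 2 := by
  have hpos : 0 < ∫ x in Metric.ball (0 : EuclideanSpace ℝ (Fin (N + 1))) 1,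
      radialProfile N j x ^ 2 := by
    rw [setIntegral_pos_iff_support_of_nonneg_ae (Filter.Eventually.of_forall fun x => sq_nonneg _)
      (integrableOn_ball_of_continuous ((contDiff_radialProfile N j).continuous.pow 2))]
    refine (Metric.measure_ball_pos volume (0 : EuclideanSpace ℝ (Fin (N + 1))) one_pos).trans_le
      (measure_mono fun x hx => ⟨?_, hx⟩)
    exact (pow_pos (radialProfile_pos hj hv hx) 2).ne'
  have hB := tendsto_setIntegral_truncatedProfile_sq hj hz hv
  have hA := tendsto_setIntegral_norm_fderiv_truncatedProfile_sq hj hz hv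
  have hlim := hA.div hB hpos.ne'
  rw [setIntegral_norm_fderiv_radialProfile_sq N hj hz, mul_div_cancel_right₀ _ hpos.ne'] at hlim
  refine ge_of_tendsto hlim ?_
  filter_upwards [hB.eventually (lt_mem_nhds hpos)] with m hm
  have h0 : truncatedProfile N j m ≠ 0 := fun h => by
    simp [h] at hm
  have := dirichletEig_one_le (contDiff_truncatedProfile hz) (hasCompactSupport_truncatedProfile hz)
    (tsupport_truncatedProfile_subset hz) h0
  simpa only [rayleighQuotient, norm_gradient_eq, Pi.div_apply] using this

end

/-- Rayleigh–Faber–Krahn: among nonempty bounded open sets of given volume in ℝⁿ,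
the unit ball minimizes the first Dirichlet eigenvalue:
`|Ω|^{2/n}·λ₁(Ω) ≥ |B|^{2/n}·λ₁(B)`. -/
theorem rayleigh_faber_krahn
    (n : ℕ) (hn : 1 ≤ n)
    (Ω : Set (EuclideanSpace ℝ (Fin n)))
    (hne : Ω.Nonempty) (hob : Bornology.IsBounded Ω) (ho : IsOpen Ω) :
    (volume Ω).toReal ^ ((2 : ℝ) / n) * dirichletEig Ω 1 ≥
      (volume (Metric.ball (0 : EuclideanSpace ℝ (Fin n)) 1)).toReal ^ ((2 : ℝ) / n) *
        dirichletEig (Metric.ball (0 : EuclideanSpace ℝ (Fin n)) 1) 1 := by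
  obtain ⟨N, rfl⟩ : ∃ N, n = N + 1 := ⟨n - 1, by omega⟩
  obtain ⟨j, hj, hz, hv⟩ := exists_profile_first_zero N
  have hω := unitBallVolume_pos N
  have hfin : volume Ω ≠ ⊤ := hob.measure_lt_top.ne
  have hVpos : 0 < (volume Ω).toReal := ENNReal.toReal_pos (ho.measure_pos volume hne).ne' hfin
  set R : ℝ := ((volume Ω).toReal / unitBallVolume N) ^ (((N + 1 : ℕ) : ℝ)⁻¹) with hRdef
  have hR : 0 < R := by positivity
  have hRpow : unitBallVolume N * R ^ (N + 1) = (volume Ω).toReal := by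
    rw [hRdef, Real.rpow_inv_natCast_pow (by positivity) N.succ_ne_zero,
      mul_div_cancel₀ _ hω.ne']
  have hvol : volume Ω ≤ volume (Metric.ball (0 : EuclideanSpace ℝ (Fin (N + 1))) R) := by
    rw [volume_ball_eq N hR.le, hRpow, ENNReal.ofReal_toReal hfin]
  have hlow : (j / R) ^ 2 ≤ dirichletEig Ω 1 := le_dirichletEig_one hne ho fun u h1 h2 h3 =>
    sq_first_zero_mul_setIntegral_sq_le hR hj hvol h1 h2 h3 hv
  have hup := dirichletEig_one_ball_le hj hz hv
  have hscale : (volume Ω).toReal ^ ((2 : ℝ) / (N + 1 : ℕ)) =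
      unitBallVolume N ^ ((2 : ℝ) / (N + 1 : ℕ)) * R ^ 2 := by
    rw [← hRpow, Real.mul_rpow hω.le (by positivity), ← Real.rpow_natCast, ← Real.rpow_mul hR.le,
      mul_div_cancel₀ _ (by positivity), Real.rpow_two]
  rw [ge_iff_le, hscale]
  calc unitBallVolume N ^ ((2 : ℝ) / (N + 1 : ℕ)) *
        dirichletEig (Metric.ball (0 : EuclideanSpace ℝ (Fin (N + 1))) 1) 1
      ≤ unitBallVolume N ^ ((2 : ℝ) / (N + 1 : ℕ)) * j ^ 2 := by gcongr
    _ = unitBallVolume N ^ ((2 : ℝ) / (N + 1 : ℕ)) * R ^ 2 * (j / R) ^ 2 := by field_simp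
    _ ≤ _ := by gcongr
end
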